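/- arXiv:2103.01799 — 2 statements merged into one kernel-verified Lean document; each statement's English description precedes it below -/
import Mathlib

section
/- Under the standing assumptions (n ≥ 3, q = p^h with h ≥ 2, and q ≥ max{32, 2^(2n−4)} if h > 2, q ≥ 2^(2n) if h = 2), every codeword c of C_{n−1}(n,q) with wt(c) ≤ W(n,q) is a linear combination of exactly ⌈wt(c)/θ_{n−1}⌉ different hyperplanes; that is, there exist m := ⌈wt(c)/θ_{n−1}⌉ pairwise distinct hyperplanes H_1, …, H_m of PG(n,q) and nonzero scalars α_1, …, α_m ∈ ℤ/pℤ with c = α_1·f_{H_1} + … + α_m·f_{H_m}. -/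
open Module

noncomputable section

/-- `pgTheta q m = 1 + q + … + q^m` for `m ≥ 0`, and `0` for `m < 0`. -/
def pgTheta (q : ℕ) (m : ℤ) : ℤ := ∑ i ∈ Finset.range (m + 1).toNat, (q : ℤ) ^ i

/-- `q^j`, truncated to `0` for negative exponents `j`. -/
def pgQpow (q : ℕ) (j : ℤ) : ℤ := if j < 0 then 0 else (q : ℤ) ^ j.toNat

/-- `Δ_{i,q}` where `q = p^h`: `⌊√q / 2^(i-2)⌋` if `h > 2`, and `⌊p / 2^i⌋` if `h = 2`. -/
noncomputable def pgDelta (p h : ℕ) (i : ℤ) : ℤ :=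
  if 2 < h then ⌊Real.sqrt ((p : ℝ) ^ h) / (2 : ℝ) ^ (i - 2)⌋
  else ⌊(p : ℝ) / (2 : ℝ) ^ i⌋

/-- `W(i,q) = (Δ_{i,q} - 1)·θ_{i-1}`. -/
noncomputable def pgW (p h : ℕ) (i : ℤ) : ℤ := (pgDelta p h i - 1) * pgTheta (p ^ h) (i - 1)

/-- `U(n,i,q) = q^i − (Δ_{n,q} − 2)·⌊q^(i−1)⌋ − (i−2)·((q−1)·Δ_{n,q} + 1)·⌊q^(i−3)⌋ + θ_{i−3}`. -/
noncomputable def pgU (p h n : ℕ) (i : ℤ) : ℤ :=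
  pgQpow (p ^ h) i - (pgDelta p h n - 2) * pgQpow (p ^ h) (i - 1)
    - (i - 2) * ((((p ^ h : ℕ) : ℤ) - 1) * pgDelta p h n + 1) * pgQpow (p ^ h) (i - 3)
    + pgTheta (p ^ h) (i - 3)

/-- `⌈w / θ_m⌉` as a natural number. -/
noncomputable def pgCeil (q w : ℕ) (m : ℤ) : ℕ := (⌈(w : ℚ) / ((pgTheta q m : ℤ) : ℚ)⌉).toNat
open scoped Classical

/-- A point of `PG(n,q)`: a 1-dimensional subspace of `F^(n+1)`. -/
abbrev PGPoint (F : Type) [Field F] (n : ℕ) :=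
  {P : Submodule F (Fin (n + 1) → F) // finrank F P = 1}

/-- The indicator function of a subspace `κ`, with values in `ZMod p`. -/
noncomputable def pgInd (p : ℕ) (F : Type) [Field F] (n : ℕ)
    (κ : Submodule F (Fin (n + 1) → F)) : PGPoint F n → ZMod p :=
  fun P => if P.1 ≤ κ then 1 else 0

/-- The code `C_{n-1}(n,q)`: the `ZMod p`-span of the indicator functions of all
hyperplanes (i.e. `n`-dimensional subspaces of `F^(n+1)`). -/
noncomputable def pgCode (p : ℕ) (F : Type) [Field F] (n : ℕ) :
    Submodule (ZMod p) (PGPoint F n → ZMod p) :=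
  Submodule.span (ZMod p)
    {f | ∃ H : Submodule F (Fin (n + 1) → F), finrank F H = n ∧ f = pgInd p F n H}

/-- The weight of a codeword: the number of points where it is nonzero. -/
noncomputable def pgWt (p : ℕ) (F : Type) [Field F] (n : ℕ)
    (c : PGPoint F n → ZMod p) : ℕ :=
  Set.ncard {P : PGPoint F n | c P ≠ 0}

/-- The number of points of `supp c` lying in the subspace `κ`. -/
noncomputable def pgSecant (p : ℕ) (F : Type) [Field F] (n : ℕ)
    (c : PGPoint F n → ZMod p) (κ : Submodule F (Fin (n + 1) → F)) : ℕ :=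
  Set.ncard {P : PGPoint F n | c P ≠ 0 ∧ P.1 ≤ κ}

/-- A codeword `c` is minimal if every codeword whose support is contained in the
support of `c` is a scalar multiple of `c`. -/
noncomputable def pgMinimal (p : ℕ) (F : Type) [Field F] (n : ℕ)
    (c : PGPoint F n → ZMod p) : Prop :=
  ∀ c' ∈ pgCode p F n, {P : PGPoint F n | c' P ≠ 0} ⊆ {P : PGPoint F n | c P ≠ 0} →
    ∃ α : ZMod p, c' = α • c

/-! ### A determinantal bound on the zeros of a polynomial family -/

section Determinant

open Polynomial
open scoped Finset

lemma natDegree_det_le_of_add {F : Type*} [Field F] {s : ℕ} (A : Matrix (Fin s) (Fin s) F[X])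
    (hA : ∀ i j, (A i j).natDegree ≤ i + j) : A.det.natDegree ≤ s * (s - 1) := by
  rw [Matrix.det_apply]
  refine natDegree_sum_le_of_forall_le _ _ fun σ _ => ?_
  have h1 : (∏ i, A (σ i) i).natDegree ≤ s * (s - 1) := by
    refine (natDegree_prod_le _ _).trans ?_
    calc ∑ i, (A (σ i) i).natDegree ≤ ∑ i : Fin s, ((σ i : ℕ) + (i : ℕ)) :=
          Finset.sum_le_sum fun i _ => hA _ _
      _ = ∑ i : Fin s, (i : ℕ) + ∑ i : Fin s, (i : ℕ) := by
          rw [Finset.sum_add_distrib, Equiv.sum_comp σ (fun i : Fin s => (i : ℕ))]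
      _ = s * (s - 1) := by
          rw [Fin.sum_univ_eq_sum_range (fun i => i), ← mul_two, Finset.sum_range_id_mul_two]
  rcases Int.units_eq_one_or (Equiv.Perm.sign σ) with h | h <;> simp [h, h1]

variable {F : Type*} [Field F] [Fintype F]

lemma natDegree_hankel_le (G : ℕ → F[X])
    (hG : ∀ k < Fintype.card F, (G k).natDegree ≤ Fintype.card F - 1 - k) (e : ℕ) :
    (∑ x : F, C (x ^ e) * ∑ k ∈ Finset.range (Fintype.card F), C (x ^ k) * G k).natDegree ≤ e := by
  have h1 : (∑ x : F, C (x ^ e) * ∑ k ∈ Finset.range (Fintype.card F), C (x ^ k) * G k)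
      = ∑ k ∈ Finset.range (Fintype.card F), C (∑ x : F, x ^ (e + k)) * G k := by
    simp_rw [Finset.mul_sum, map_sum, Finset.sum_mul]
    rw [Finset.sum_comm]
    refine Finset.sum_congr rfl fun k _ => Finset.sum_congr rfl fun x _ => ?_
    rw [pow_add, map_mul, mul_assoc]
  rw [h1]
  refine natDegree_sum_le_of_forall_le _ _ fun k hk => ?_
  rw [Finset.mem_range] at hk
  by_cases hlt : e + k < Fintype.card F - 1
  · rw [FiniteField.sum_pow_lt_card_sub_one F _ hlt]
    simp
  · refine (natDegree_C_mul_le _ _).trans ((hG k hk).trans ?_)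
    omega

lemma X_sub_C_pow_dvd_hankel_det {s : ℕ} (g : F → F[X]) (z : F) :
    (X - C z) ^ (s - #{x : F | (g x).eval z ≠ 0}) ∣
      (Matrix.of fun i j : Fin s => ∑ x : F, C (x ^ ((i : ℕ) + j)) * g x).det := by
  have hrow : (Matrix.of fun i j : Fin s => ∑ x : F, C (x ^ ((i : ℕ) + j)) * g x)
      = fun i : Fin s => ∑ x : F, (fun j : Fin s => C (x ^ ((i : ℕ) + j)) * g x) := by
    ext1 i j
    simp [Finset.sum_apply]
  have hdet : (Matrix.of fun i j : Fin s => ∑ x : F, C (x ^ ((i : ℕ) + j)) * g x).det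
      = ∑ r : Fin s → F, (Matrix.of fun i j : Fin s => C (r i ^ ((i : ℕ) + j)) * g (r i)).det := by
    rw [hrow]
    exact Matrix.detRowAlternating.toMultilinearMap.map_sum
      (fun (i : Fin s) (x : F) (j : Fin s) => C (x ^ ((i : ℕ) + j)) * g x)
  rw [hdet]
  refine Finset.dvd_sum fun r _ => ?_
  have hfac : (Matrix.of fun i j : Fin s => C (r i ^ ((i : ℕ) + j)) * g (r i)).det
      = (∏ i, C (r i ^ (i : ℕ)) * g (r i)) *
        (Matrix.of fun i j : Fin s => C (r i ^ (j : ℕ))).det := by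
    rw [← Matrix.det_mul_column]
    congr 1
    ext1 i j
    simp only [Matrix.of_apply, pow_add, map_mul]
    ring
  rw [hfac]
  by_cases hr : Function.Injective r
  · refine Dvd.dvd.mul_right ?_ _
    rw [Finset.prod_mul_distrib]
    refine Dvd.dvd.mul_left ?_ _
    set Z : Finset (Fin s) := {i | (g (r i)).eval z = 0} with hZ
    have hcard : s - #{x : F | (g x).eval z ≠ 0} ≤ Z.card := by
      have h1 : #{i : Fin s | ¬ (g (r i)).eval z = 0} ≤ #{x : F | (g x).eval z ≠ 0} :=
        Finset.card_le_card_of_injOn r (by intro i; simp) hr.injOn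
      have h2 := Finset.card_filter_add_card_filter_not (s := (Finset.univ : Finset (Fin s)))
        (fun i => (g (r i)).eval z = 0)
      rw [← hZ] at h2
      rw [Finset.card_univ, Fintype.card_fin] at h2
      omega
    refine (pow_dvd_pow _ hcard).trans ?_
    refine Dvd.dvd.trans ?_ (Finset.prod_dvd_prod_of_subset Z Finset.univ _ (Finset.subset_univ _))
    rw [← Finset.prod_const]
    refine Finset.prod_dvd_prod_of_dvd _ _ fun i hi => ?_
    rw [dvd_iff_isRoot]
    simpa [hZ] using hi
  · rw [Function.Injective] at hr
    push Not at hr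
    obtain ⟨i, j, hij, hne⟩ := hr
    rw [Matrix.det_zero_of_row_eq hne (by ext1 k; simp [hij]), mul_zero]
    exact dvd_zero _

lemma hankel_det_ne_zero (g : F → F) :
    (Matrix.of fun i j : Fin #{x : F | g x ≠ 0} =>
      ∑ x : F, x ^ ((i : ℕ) + j) * g x).det ≠ 0 := by
  set S : Finset F := {x : F | g x ≠ 0} with hS
  let e : Fin S.card ≃ S := S.equivFin.symm
  have hmul : (Matrix.of fun i j : Fin S.card => ∑ x : F, x ^ ((i : ℕ) + j) * g x)
      = (Matrix.vandermonde fun k => (e k : F)).transpose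
        * (Matrix.diagonal fun k => g (e k)) * Matrix.vandermonde fun k => (e k : F) := by
    ext i j
    rw [Matrix.mul_apply]
    simp only [Matrix.of_apply, Matrix.mul_diagonal, Matrix.transpose_apply,
      Matrix.vandermonde_apply]
    rw [Equiv.sum_comp e (fun k : S => (k : F) ^ (i : ℕ) * g k * (k : F) ^ (j : ℕ)),
      Finset.sum_coe_sort S (fun k => k ^ (i : ℕ) * g k * k ^ (j : ℕ))]
    rw [← Finset.sum_subset (Finset.subset_univ S)]
    · exact Finset.sum_congr rfl fun x _ => by ring
    · intro x _ hx
      have : g x = 0 := by simpa [hS] using hx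
      simp [this]
  rw [hmul, Matrix.det_mul, Matrix.det_mul, Matrix.det_transpose, Matrix.det_diagonal]
  have hv : (Matrix.vandermonde fun k => (e k : F)).det ≠ 0 :=
    Matrix.det_vandermonde_ne_zero_iff.2 (Subtype.val_injective.comp e.injective)
  refine mul_ne_zero (mul_ne_zero hv (Finset.prod_ne_zero_iff.2 fun k _ => ?_)) hv
  exact (Finset.mem_filter.1 (e k).2).2

/-- For a bivariate polynomial `∑ x ^ k * G k (z)` of total degree less than `q`, the numbers of
nonzeros on the rows `z` exceed that of the row `z = 0`, up to a quadratic total defect. -/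
lemma sum_defect_le (G : ℕ → F[X])
    (hG : ∀ k < Fintype.card F, (G k).natDegree ≤ Fintype.card F - 1 - k) (g : F → F[X])
    (hg : ∀ x, g x = ∑ k ∈ Finset.range (Fintype.card F), C (x ^ k) * G k) :
    ∑ z : F, (#{x : F | (g x).eval 0 ≠ 0} - #{x : F | (g x).eval z ≠ 0}) ≤
      #{x : F | (g x).eval 0 ≠ 0} * (#{x : F | (g x).eval 0 ≠ 0} - 1) := by
  set s := #{x : F | (g x).eval 0 ≠ 0} with hs
  set A := (Matrix.of fun i j : Fin s => ∑ x : F, C (x ^ ((i : ℕ) + j)) * g x) with hA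
  have hdeg : A.det.natDegree ≤ s * (s - 1) := by
    refine natDegree_det_le_of_add A fun i j => ?_
    simp only [hA, Matrix.of_apply, hg]
    exact natDegree_hankel_le G hG _
  have hne : A.det ≠ 0 := by
    intro h0
    have h1 : (Polynomial.evalRingHom (0 : F)) A.det = 0 := by rw [h0, map_zero]
    rw [RingHom.map_det] at h1
    refine hankel_det_ne_zero (fun x => (g x).eval 0) ?_
    convert h1 using 2
    ext i j
    simp [hA, eval_finsetSum]
  calc ∑ z : F, (s - #{x : F | (g x).eval z ≠ 0}) ≤ ∑ z : F, A.det.roots.count z := by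
        refine Finset.sum_le_sum fun z _ => ?_
        rw [count_roots, le_rootMultiplicity_iff hne]
        exact X_sub_C_pow_dvd_hankel_det g z
    _ = A.det.roots.card := by
        exact Multiset.sum_count_eq_card fun a _ => Finset.mem_univ a
    _ ≤ A.det.natDegree := card_roots' _
    _ ≤ s * (s - 1) := hdeg

end Determinant

/-! ### The code of hyperplanes of a vector space -/

section HyperplaneCode

open Polynomial
open scoped Finset

/-- The `ZMod p`-span of the indicator functions of the kernels of all linear forms on `V`. -/
def hypCode (p : ℕ) (F V : Type*) [Field F] [AddCommGroup V] [Module F V] :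
    Submodule (ZMod p) (V → ZMod p) :=
  Submodule.span (ZMod p)
    (Set.range fun φ : Module.Dual F V => fun v => if φ v = 0 then (1 : ZMod p) else 0)

lemma hypCode_comp {p : ℕ} {F V W : Type*} [Field F] [AddCommGroup V] [Module F V]
    [AddCommGroup W] [Module F W] {c : V → ZMod p} (hc : c ∈ hypCode p F V) (g : W →ₗ[F] V) :
    (fun x => c (g x)) ∈ hypCode p F W := by
  unfold hypCode at hc
  induction hc using Submodule.span_induction with
  | mem x hx =>
    obtain ⟨φ, rfl⟩ := hx
    exact Submodule.subset_span ⟨φ.comp g, rfl⟩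
  | zero => exact Submodule.zero_mem _
  | add x y _ _ hx hy => exact Submodule.add_mem _ hx hy
  | smul a x _ hx => exact Submodule.smul_mem _ a hx

lemma hypCode_smul {p : ℕ} {F V : Type*} [Field F] [AddCommGroup V] [Module F V]
    {c : V → ZMod p} (hc : c ∈ hypCode p F V) {t : F} (ht : t ≠ 0) (v : V) : c (t • v) = c v := by
  unfold hypCode at hc
  induction hc using Submodule.span_induction with
  | mem x hx =>
    obtain ⟨φ, rfl⟩ := hx
    simp [ht]
  | zero => rfl
  | add x y _ _ hx hy => simp [hx, hy]
  | smul a x _ hx => simp [hx]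

lemma castHom_ne_zero_iff {p : ℕ} {F : Type*} [Field F] [Fact p.Prime] [CharP F p] (a : ZMod p) :
    ZMod.castHom (dvd_refl p) F a ≠ 0 ↔ a ≠ 0 :=
  map_ne_zero_iff _ (ZMod.castHom (dvd_refl p) F).injective

variable {p : ℕ} {F V : Type*} [Field F] [Fintype F] [AddCommGroup V] [Module F V]

lemma hypCode_exists_polynomial [CharP F p] {c : V → ZMod p} (hc : c ∈ hypCode p F V) (u v w : V) :
    ∃ G : ℕ → F[X], (∀ k < Fintype.card F, (G k).natDegree ≤ Fintype.card F - 1 - k) ∧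
      ∀ x z : F, ZMod.castHom dvd_rfl F (c (v + x • u + z • w)) =
        ∑ k ∈ Finset.range (Fintype.card F), x ^ k * (G k).eval z := by
  unfold hypCode at hc
  have hq : Fintype.card F - 1 + 1 = Fintype.card F :=
    Nat.sub_add_cancel Fintype.card_pos
  induction hc using Submodule.span_induction with
  | mem y hy =>
    obtain ⟨φ, rfl⟩ := hy
    refine ⟨fun k => C (if k = 0 then 1 else 0) -
      C (φ u ^ k * ((Fintype.card F - 1).choose k : F)) *
        (C (φ v) + C (φ w) * X) ^ (Fintype.card F - 1 - k), fun k _ => ?_, fun x z => ?_⟩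
    · refine (natDegree_sub_le _ _).trans (max_le ((natDegree_C _).le.trans (Nat.zero_le _)) ?_)
      refine (natDegree_C_mul_le _ _).trans (natDegree_pow_le.trans ?_)
      have h1 : (C (φ v) + C (φ w) * X).natDegree ≤ 1 := by
        rw [add_comm]
        exact natDegree_linear_le
      simpa using Nat.mul_le_mul_left (Fintype.card F - 1 - k) h1
    · have h1 : ∑ k ∈ Finset.range (Fintype.card F), x ^ k * (if k = 0 then (1 : F) else 0)
          = 1 := by
        rw [Finset.sum_eq_single 0]
        · simp
        · intro k _ hk
          simp [hk]
        · intro h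
          exact absurd (Finset.mem_range.2 Fintype.card_pos) h
      have h2 : ∑ k ∈ Finset.range (Fintype.card F), x ^ k * (φ u ^ k *
            ((Fintype.card F - 1).choose k : F) * (φ v + φ w * z) ^ (Fintype.card F - 1 - k))
          = (x * φ u + (φ v + φ w * z)) ^ (Fintype.card F - 1) := by
        rw [add_pow, hq]
        refine Finset.sum_congr rfl fun k _ => ?_
        ring
      simp only [eval_sub, eval_C, eval_mul, eval_pow, eval_add, eval_X, mul_sub,
        Finset.sum_sub_distrib, h1, h2]
      have h3 : φ (v + x • u + z • w) = x * φ u + (φ v + φ w * z) := by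
        simp only [map_add, map_smul, smul_eq_mul]
        ring
      rw [h3]
      by_cases h0 : x * φ u + (φ v + φ w * z) = 0
      · rw [if_pos h0, h0, zero_pow (Nat.sub_pos_of_lt Fintype.one_lt_card).ne']
        simp
      · rw [if_neg h0, FiniteField.pow_card_sub_one_eq_one _ h0]
        simp
  | zero => exact ⟨0, by simp, by simp⟩
  | add y y' _ _ hy hy' =>
    obtain ⟨G, hG, hGe⟩ := hy
    obtain ⟨G', hG', hGe'⟩ := hy'
    refine ⟨G + G', fun k hk => ?_, fun x z => ?_⟩
    · exact (natDegree_add_le _ _).trans (max_le (hG k hk) (hG' k hk))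
    · simp only [Pi.add_apply, map_add, hGe, hGe', eval_add, mul_add, Finset.sum_add_distrib]
  | smul a y _ hy =>
    obtain ⟨G, hG, hGe⟩ := hy
    refine ⟨fun k => C (ZMod.castHom dvd_rfl F a) * G k, fun k hk => ?_, fun x z => ?_⟩
    · exact (natDegree_C_mul_le _ _).trans (hG k hk)
    · simp only [Pi.smul_apply, smul_eq_mul, map_mul, hGe, eval_mul, eval_C, Finset.mul_sum]
      exact Finset.sum_congr rfl fun k _ => by ring

/-- The number of support points on the line through `u` and `v`, the point `u` excepted. -/
def affineCount (F : Type*) [Field F] [Fintype F] [Module F V] (c : V → ZMod p) (u v : V) : ℕ :=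
  #{x : F | c (v + x • u) ≠ 0}

/-- The number of support points on the line through `u` and `v`. -/
def lineCount (F : Type*) [Field F] [Fintype F] [Module F V] (c : V → ZMod p) (u v : V) : ℕ :=
  (if c u ≠ 0 then 1 else 0) + affineCount F c u v

/-- The number of support points in the affine plane through `w` with directions `u` and `v`. -/
def planeCount (F : Type*) [Field F] [Fintype F] [Module F V] (c : V → ZMod p) (u v w : V) : ℕ :=
  #{y : F × F | c (w + y.1 • u + y.2 • v) ≠ 0}

lemma affineCount_mul_le_planeCount [Fact p.Prime] [CharP F p] {c : V → ZMod p}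
    (hc : c ∈ hypCode p F V) (u v w : V) :
    affineCount F c u v * (Fintype.card F - affineCount F c u v) ≤ planeCount F c u v w := by
  obtain ⟨G, hG, hGe⟩ := hypCode_exists_polynomial hc u v w
  set r : F → ℕ := fun z => #{x : F | c (v + x • u + z • w) ≠ 0} with hr
  set s := affineCount F c u v with hs
  have hr0 : r 0 = s := by simp [hr, hs, affineCount]
  have hdef : ∑ z : F, (s - r z) ≤ s * (s - 1) := by
    have h := sum_defect_le G hG
      (fun x => ∑ k ∈ Finset.range (Fintype.card F), C (x ^ k) * G k) fun x => rfl
    have hcount : ∀ z, #{x : F | (∑ k ∈ Finset.range (Fintype.card F), C (x ^ k) * G k).eval z ≠ 0}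
        = r z := by
      intro z
      simp only [hr]
      congr 1
      ext x
      simp only [Finset.mem_filter, Finset.mem_univ, true_and]
      rw [← castHom_ne_zero_iff (F := F), hGe]
      simp [eval_finsetSum]
    simp only [hcount, hr0] at h
    exact h
  have hle : ∑ z ∈ Finset.univ.erase (0 : F), r z ≤ planeCount F c u v w := by
    have h1 : ∑ z ∈ Finset.univ.erase (0 : F), r z
        = #((Finset.univ.erase (0 : F)).sigma fun z => {x : F | c (v + x • u + z • w) ≠ 0}) := by
      rw [Finset.card_sigma]
    rw [h1]
    refine Finset.card_le_card_of_injOn (fun a => (a.1⁻¹ * a.2, a.1⁻¹)) ?_ ?_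
    · rintro ⟨z, x⟩ ha
      simp only [Finset.coe_sigma, Set.mem_sigma_iff, Finset.mem_coe, Finset.mem_erase,
        Finset.mem_univ, and_true, Finset.mem_filter, true_and] at ha
      simp only [Finset.coe_filter, Finset.mem_univ, true_and, Set.mem_ofPred_eq]
      rw [← hypCode_smul hc ha.1]
      convert ha.2 using 2
      simp only [smul_add, smul_smul]
      rw [mul_inv_cancel_left₀ ha.1, mul_inv_cancel₀ ha.1, one_smul]
      abel
    · rintro ⟨z, x⟩ ha ⟨z', x'⟩ ha' h
      simp only [Finset.coe_sigma, Set.mem_sigma_iff, Finset.mem_coe, Finset.mem_erase,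
        Finset.mem_univ, and_true, Finset.mem_filter, true_and] at ha
      simp only [Prod.mk.injEq, inv_inj] at h
      obtain ⟨h2, rfl⟩ := h
      have h3 : x = x' := mul_left_cancel₀ (inv_ne_zero ha.1) h2
      rw [h3]
  have hsq : s ≤ Fintype.card F := Finset.card_le_univ _
  have hlow : (Fintype.card F - 1) * s ≤ ∑ z ∈ Finset.univ.erase (0 : F), (r z + (s - r z)) := by
    have h1 : #(Finset.univ.erase (0 : F)) = Fintype.card F - 1 := by
      rw [Finset.card_erase_of_mem (Finset.mem_univ _), Finset.card_univ]
    rw [← h1, ← smul_eq_mul]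
    exact Finset.card_nsmul_le_sum _ _ _ fun z _ => by omega
  rw [Finset.sum_add_distrib] at hlow
  have hsub : ∑ z ∈ Finset.univ.erase (0 : F), (s - r z) ≤ ∑ z : F, (s - r z) :=
    Finset.sum_le_sum_of_subset (Finset.subset_univ _)
  rcases Nat.eq_zero_or_pos s with h0 | hpos
  · simp [h0]
  · have h1 : s * (Fintype.card F - s) + s * (s - 1) = (Fintype.card F - 1) * s := by
      rw [← mul_add, mul_comm]
      congr 1
      omega
    omega

lemma lineCount_shear (c : V → ZMod p) (u v : V) (a : F) :
    lineCount F c u (v + a • u) = lineCount F c u v := by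
  unfold lineCount affineCount
  congr 1
  refine Finset.card_bij (fun x _ => a + x) ?_ ?_ ?_
  · intro x hx
    simpa [add_smul, add_assoc] using hx
  · intro x _ y _ h
    exact add_left_cancel h
  · intro y hy
    refine ⟨y - a, ?_, by ring⟩
    simpa [sub_smul, add_assoc] using hy

lemma lineCount_comm {c : V → ZMod p} (hc : c ∈ hypCode p F V) (u v : V) :
    lineCount F c u v = lineCount F c v u := by
  have key : ∀ u v : V, affineCount F c u v =
      (if c v ≠ 0 then 1 else 0) + #{x : F | x ≠ 0 ∧ c (v + x • u) ≠ 0} := by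
    intro u v
    unfold affineCount
    rw [Finset.card_filter, Finset.card_filter,
      ← Finset.add_sum_erase _ _ (Finset.mem_univ (0 : F)),
      ← Finset.add_sum_erase _ (fun x : F => if x ≠ 0 ∧ c (v + x • u) ≠ 0 then 1 else 0)
        (Finset.mem_univ (0 : F))]
    simp only [zero_smul, add_zero, ne_eq, not_true_eq_false, false_and, if_false, zero_add]
    congr 1
    refine Finset.sum_congr rfl fun x hx => ?_
    simp [(Finset.mem_erase.1 hx).1]
  have hinv : #{x : F | x ≠ 0 ∧ c (v + x • u) ≠ 0} = #{x : F | x ≠ 0 ∧ c (u + x • v) ≠ 0} := by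
    have haux : ∀ (u v : V) (x : F), x ≠ 0 → c (v + x • u) = c (u + x⁻¹ • v) := by
      intro u v x hx
      rw [← hypCode_smul hc (inv_ne_zero hx), smul_add, smul_smul, inv_mul_cancel₀ hx, one_smul,
        add_comm]
    refine Finset.card_bij (fun x _ => x⁻¹) ?_ ?_ ?_
    · intro x hx
      simp only [Finset.mem_filter, Finset.mem_univ, true_and] at hx ⊢
      exact ⟨inv_ne_zero hx.1, by rw [← haux u v x hx.1]; exact hx.2⟩
    · intro x _ y _ h
      exact inv_injective h
    · intro y hy
      simp only [Finset.mem_filter, Finset.mem_univ, true_and] at hy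
      refine ⟨y⁻¹, ?_, inv_inv y⟩
      simp only [Finset.mem_filter, Finset.mem_univ, true_and]
      exact ⟨inv_ne_zero hy.1, by rw [← haux v u y hy.1]; exact hy.2⟩
  unfold lineCount
  rw [key u v, key v u, hinv]
  omega

lemma planeCount_comm (c : V → ZMod p) (u v w : V) :
    planeCount F c u v w = planeCount F c v u w := by
  unfold planeCount
  refine Finset.card_bij (fun y _ => y.swap) ?_ ?_ ?_
  · intro y hy
    simpa [add_right_comm] using hy
  · intro x _ y _ h
    exact Prod.swap_injective h
  · intro y hy
    exact ⟨y.swap, by simpa [add_right_comm] using hy, Prod.swap_swap y⟩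

lemma planeCount_shear (c : V → ZMod p) (u v w : V) (a : F) :
    planeCount F c u (v + a • u) w = planeCount F c u v w := by
  unfold planeCount
  refine Finset.card_bij (fun y _ => (y.1 + y.2 * a, y.2)) ?_ ?_ ?_
  · intro y hy
    simp only [Finset.mem_filter, Finset.mem_univ, true_and] at hy ⊢
    convert hy using 2
    module
  · intro x _ y _ h
    simp only [Prod.mk.injEq] at h
    obtain ⟨h1, h2⟩ := h
    rw [h2] at h1
    exact Prod.ext (add_right_cancel h1) h2
  · intro y hy
    refine ⟨(y.1 - y.2 * a, y.2), ?_, by simp⟩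
    simp only [Finset.mem_filter, Finset.mem_univ, true_and] at hy ⊢
    convert hy using 2
    module

lemma lineCount_le (c : V → ZMod p) (u v : V) : lineCount F c u v ≤ Fintype.card F + 1 := by
  unfold lineCount affineCount
  have h1 : #{x : F | c (v + x • u) ≠ 0} ≤ Fintype.card F := Finset.card_le_univ _
  split_ifs <;> omega

/-- A line at infinity with `s` support points forces `s * (q - s)` affine support points. -/
lemma lineCount_mul_le_planeCount [Fact p.Prime] [CharP F p] {c : V → ZMod p}
    (hc : c ∈ hypCode p F V) (u v w : V) :
    lineCount F c u v * (Fintype.card F - lineCount F c u v) ≤ planeCount F c u v w := by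
  have key : ∀ u v : V, c u = 0 →
      lineCount F c u v * (Fintype.card F - lineCount F c u v) ≤ planeCount F c u v w := by
    intro u v hu
    have h1 : lineCount F c u v = affineCount F c u v := by simp [lineCount, hu]
    rw [h1]
    exact affineCount_mul_le_planeCount hc u v w
  by_cases hu : c u = 0
  · exact key u v hu
  by_cases hx : ∃ x : F, c (v + x • u) = 0
  · obtain ⟨x, hx⟩ := hx
    rw [← lineCount_shear c u v x, ← planeCount_shear c u v w x, lineCount_comm hc,
      planeCount_comm]
    exact key _ _ hx
  · push Not at hx
    have h1 : lineCount F c u v = 1 + Fintype.card F := by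
      simp [lineCount, affineCount, hu, hx]
    rw [h1]
    simp

end HyperplaneCode

/-! ### Short and long lines, small and large hyperplanes -/

section Dichotomy

open scoped Finset

lemma card_filter_submodule {F V : Type*} [Field F] [AddCommGroup V] [Module F V] [Fintype V]
    (H : Submodule F V) [Fintype H] (P : V → Prop) :
    #{v : H | P v} = #{v : V | v ∈ H ∧ P v} := by
  refine Finset.card_bij (fun v _ => (v : V)) ?_ ?_ ?_
  · intro v hv
    simpa using hv
  · intro v _ w _ h
    exact Subtype.ext h
  · intro v hv
    simp only [Finset.mem_filter, Finset.mem_univ, true_and] at hv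
    exact ⟨⟨v, hv.1⟩, by simpa using hv.2, rfl⟩

variable {p : ℕ} {F V : Type*} [Field F] [Fintype F] [AddCommGroup V] [Module F V]

/-- Every line has at most `M` or at least `q - M` support points. -/
def ShortOrLong (F : Type*) [Field F] [Fintype F] [Module F V] (c : V → ZMod p) (M : ℕ) : Prop :=
  ∀ u v : V, lineCount F c u v ≤ M ∨ Fintype.card F ≤ lineCount F c u v + M

/-- Through a support point, every plane contains a long line. -/
lemma exists_long_line [Fact p.Prime] [CharP F p] {c : V → ZMod p} (hc : c ∈ hypCode p F V)
    {M : ℕ} (hsl : ShortOrLong F c M) (hM : M ^ 2 < Fintype.card F) {w : V} (hw : c w ≠ 0)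
    (v₁ v₂ : V) :
    ∃ a b : F, (a ≠ 0 ∨ b ≠ 0) ∧
      Fintype.card F ≤ lineCount F c w (a • v₁ + b • v₂) + M := by
  by_contra! hcon
  have hshort : ∀ a b : F, (a ≠ 0 ∨ b ≠ 0) → lineCount F c w (a • v₁ + b • v₂) ≤ M :=
    fun a b hab => (hsl _ _).resolve_right (not_le.2 (hcon a b hab))
  obtain ⟨⟨a, b⟩, hab, hmax⟩ := Finset.exists_max_image
    ({y | y.1 ≠ 0 ∨ y.2 ≠ 0} : Finset (F × F)) (fun y => lineCount F c w (y.1 • v₁ + y.2 • v₂))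
    ⟨(1, 0), by simp⟩
  simp only [Finset.mem_filter, Finset.mem_univ, true_and] at hab hmax
  set s := lineCount F c w (a • v₁ + b • v₂) with hs
  have hs1 : ∀ v, lineCount F c w v = 1 + affineCount F c w v := by
    intro v
    simp [lineCount, hw]
  obtain ⟨a', b', hdet⟩ : ∃ a' b' : F, ∀ y : F, a' + y * a ≠ 0 ∨ b' + y * b ≠ 0 := by
    by_cases ha : a = 0
    · exact ⟨1, 0, fun y => Or.inl (by simp [ha])⟩
    · refine ⟨0, 1, fun y => ?_⟩
      by_cases hy : y = 0
      · exact Or.inr (by simp [hy])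
      · exact Or.inl (by simp [hy, ha])
  have hplane := lineCount_mul_le_planeCount hc w (a • v₁ + b • v₂) (a' • v₁ + b' • v₂)
  have hsum : planeCount F c w (a • v₁ + b • v₂) (a' • v₁ + b' • v₂)
      = ∑ y : F, affineCount F c w ((a' + y * a) • v₁ + (b' + y * b) • v₂) := by
    unfold planeCount affineCount
    simp_rw [Finset.card_filter]
    rw [Fintype.sum_prod_type_right]
    refine Finset.sum_congr rfl fun y _ => Finset.sum_congr rfl fun x _ => ?_
    have h : a' • v₁ + b' • v₂ + x • w + y • (a • v₁ + b • v₂)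
        = (a' + y * a) • v₁ + (b' + y * b) • v₂ + x • w := by module
    rw [h]
  have hle : planeCount F c w (a • v₁ + b • v₂) (a' • v₁ + b' • v₂)
      ≤ Fintype.card F * (s - 1) := by
    rw [hsum, ← Finset.card_univ, ← smul_eq_mul]
    refine Finset.sum_le_card_nsmul _ _ _ fun y _ => ?_
    have h : lineCount F c w ((a' + y * a) • v₁ + (b' + y * b) • v₂) ≤ s :=
      hmax (a' + y * a, b' + y * b) (hdet y)
    rw [hs1] at h
    omega
  have hsM : s ≤ M := hshort a b hab
  have hspos : 1 ≤ s := by rw [hs, hs1]; omega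
  rw [← hs] at hplane
  have h := hplane.trans hle
  clear_value s
  obtain ⟨t, rfl⟩ : ∃ t, s = t + 1 := ⟨s - 1, by omega⟩
  obtain ⟨r, hr⟩ := Nat.exists_eq_add_of_le (show t + 1 ≤ Fintype.card F by nlinarith)
  rw [hr] at h hM
  simp only [Nat.add_sub_cancel_left, Nat.add_sub_cancel] at h
  nlinarith

variable [Fintype V]

lemma sum_planeCount (c : V → ZMod p) (u v : V) :
    ∑ w : V, planeCount F c u v w = Fintype.card F ^ 2 * #{w : V | c w ≠ 0} := by
  unfold planeCount
  simp_rw [Finset.card_filter]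
  rw [Finset.sum_comm]
  have h1 : ∀ y : F × F, ∑ w : V, (if c (w + y.1 • u + y.2 • v) ≠ 0 then 1 else 0)
      = ∑ w : V, if c w ≠ 0 then 1 else 0 := by
    intro y
    simp_rw [add_assoc]
    exact Equiv.sum_comp (Equiv.addRight (y.1 • u + y.2 • v)) fun w => if c w ≠ 0 then 1 else 0
  simp_rw [h1]
  rw [Finset.sum_const, Finset.card_univ, Fintype.card_prod, smul_eq_mul, sq]

lemma shortOrLong_of_card_le [Fact p.Prime] [CharP F p] {c : V → ZMod p}
    (hc : c ∈ hypCode p F V) {M : ℕ}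
    (hS : Fintype.card F * #{v : V | c v ≠ 0} ≤ M * Fintype.card V)
    (hM : (M + 1) ^ 2 < Fintype.card F) : ShortOrLong F c M := by
  intro u v
  set q := Fintype.card F with hq
  set s := lineCount F c u v with hs
  have h1 : Fintype.card V * (s * (q - s)) ≤ q ^ 2 * #{v : V | c v ≠ 0} := by
    rw [← sum_planeCount c u v, ← Finset.card_univ, ← smul_eq_mul]
    exact Finset.card_nsmul_le_sum _ _ _ fun w _ => lineCount_mul_le_planeCount hc u v w
  have h2 : Fintype.card V * (s * (q - s)) ≤ Fintype.card V * (q * M) := by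
    refine h1.trans ?_
    calc q ^ 2 * #{v : V | c v ≠ 0} = q * (q * #{v : V | c v ≠ 0}) := by ring
      _ ≤ q * (M * Fintype.card V) := Nat.mul_le_mul_left _ hS
      _ = Fintype.card V * (q * M) := by ring
  have h3 : s * (q - s) ≤ q * M := Nat.le_of_mul_le_mul_left h2 Fintype.card_pos
  by_contra! hcon
  obtain ⟨a, ha⟩ := Nat.exists_eq_add_of_lt hcon.1
  obtain ⟨b, hb⟩ := Nat.exists_eq_add_of_lt hcon.2
  have h4 : q - s = M + b + 1 := by omega
  rw [h4] at h3
  rw [ha] at h3 hb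
  rw [hb] at h3 hM
  nlinarith [Nat.zero_le (a * b)]

lemma card_support_mul_card_zero_le {c : V → ZMod p} (hc : c ∈ hypCode p F V) {M : ℕ}
    (hsl : ShortOrLong F c M) :
    Fintype.card F * (#{v : V | c v ≠ 0} * #{v : V | c v = 0}) ≤
      Fintype.card V ^ 2 * (M + 1) := by
  set q := Fintype.card F with hq
  set f : V → ℕ := fun v => if c v ≠ 0 then 1 else 0 with hf
  set g : V → ℕ := fun v => if c v = 0 then 1 else 0 with hg
  have hF : #{v : V | c v ≠ 0} = ∑ v, f v := Finset.card_filter _ _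
  have hG : #{v : V | c v = 0} = ∑ v, g v := Finset.card_filter _ _
  have hfg : ∀ u v : V, f u * ∑ x : F, g (v + x • u) = f u * (q + 1 - lineCount F c u v) := by
    intro u v
    by_cases hu : c u = 0
    · simp [hf, hu]
    · have h1 := Finset.card_filter_add_card_filter_not (s := (Finset.univ : Finset F))
        (fun x => c (v + x • u) = 0)
      rw [Finset.card_univ, ← hq] at h1
      have h2 : ∑ x : F, g (v + x • u) = #{x : F | c (v + x • u) = 0} :=
        (Finset.card_filter _ _).symm
      have h3 : lineCount F c u v = 1 + #{x : F | ¬ c (v + x • u) = 0} := by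
        simp [lineCount, affineCount, hu]
      congr 1
      omega
  have hshift : ∀ (k : V → ℕ) (t : V), ∑ v, k (v + t) = ∑ v, k v := fun k t =>
    Equiv.sum_comp (Equiv.addRight t) k
  have hstep : q * ((∑ u, f u) * ∑ v, g v) = ∑ u, ∑ v, f u * (q + 1 - lineCount F c u v) := by
    calc q * ((∑ u, f u) * ∑ v, g v) = ∑ u, f u * ∑ _x : F, ∑ v, g v := by
          rw [Finset.sum_const, Finset.card_univ, smul_eq_mul, ← Finset.sum_mul]
          ring
      _ = ∑ u, f u * ∑ x : F, ∑ v, g (v + x • u) := by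
          refine Finset.sum_congr rfl fun u _ => ?_
          congr 1
          exact Finset.sum_congr rfl fun x _ => (hshift g _).symm
      _ = _ := by
          refine Finset.sum_congr rfl fun u _ => ?_
          rw [Finset.sum_comm, Finset.mul_sum]
          exact Finset.sum_congr rfl fun v _ => hfg u v
  have hstep' : q * ∑ u, ∑ v, f u * (q + 1 - lineCount F c u v)
      ≤ ∑ v : V, ∑ u : V, lineCount F c u v * (q + 1 - lineCount F c u v) := by
    rw [Finset.sum_comm, Finset.mul_sum]
    refine Finset.sum_le_sum fun v _ => ?_
    have h1 : ∀ y : F, ∑ u, f u * (q + 1 - lineCount F c u v)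
        = ∑ u, f (u + y • v) * (q + 1 - lineCount F c u v) := by
      intro y
      rw [← hshift (fun u => f u * (q + 1 - lineCount F c u v)) (y • v)]
      refine Finset.sum_congr rfl fun u _ => ?_
      rw [lineCount_comm hc (u + y • v) v, lineCount_shear, lineCount_comm hc v u]
    calc q * ∑ u, f u * (q + 1 - lineCount F c u v)
        = ∑ _y : F, ∑ u, f u * (q + 1 - lineCount F c u v) := by
          rw [Finset.sum_const, Finset.card_univ, smul_eq_mul]
      _ = ∑ y : F, ∑ u, f (u + y • v) * (q + 1 - lineCount F c u v) :=
          Finset.sum_congr rfl fun y _ => h1 y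
      _ = ∑ u, (∑ y : F, f (u + y • v)) * (q + 1 - lineCount F c u v) := by
          rw [Finset.sum_comm]
          exact Finset.sum_congr rfl fun u _ => (Finset.sum_mul _ _ _).symm
      _ ≤ _ := by
          refine Finset.sum_le_sum fun u _ => Nat.mul_le_mul_right _ ?_
          rw [lineCount_comm hc u v]
          unfold lineCount affineCount
          rw [Finset.card_filter]
          exact Nat.le_add_left _ _
  have hbound : ∀ u v : V, lineCount F c u v * (q + 1 - lineCount F c u v) ≤ (M + 1) * q := by
    intro u v
    have hle := lineCount_le (F := F) c u v
    rw [← hq] at hle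
    set s := lineCount F c u v
    obtain ⟨t, ht⟩ := Nat.exists_eq_add_of_le hle
    have h1 : q + 1 - s = t := by omega
    rw [h1]
    rcases hsl u v with h | h
    · rcases Nat.eq_zero_or_pos s with h0 | h0
      · simp [h0]
      · exact Nat.mul_le_mul (by omega) (by omega)
    · rcases Nat.eq_zero_or_pos t with h0 | h0
      · simp [h0]
      · rw [mul_comm]
        exact Nat.mul_le_mul (by omega) (by omega)
  have hfin : q * (q * ((∑ u, f u) * ∑ v, g v)) ≤ q * (Fintype.card V ^ 2 * (M + 1)) := by
    rw [hstep]
    refine hstep'.trans ?_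
    calc ∑ v : V, ∑ u : V, lineCount F c u v * (q + 1 - lineCount F c u v)
        ≤ ∑ _v : V, ∑ _u : V, (M + 1) * q :=
          Finset.sum_le_sum fun v _ => Finset.sum_le_sum fun u _ => hbound u v
      _ = q * (Fintype.card V ^ 2 * (M + 1)) := by
          simp only [Finset.sum_const, Finset.card_univ, smul_eq_mul]
          ring
  rw [hF, hG]
  exact Nat.le_of_mul_le_mul_left hfin Fintype.card_pos

lemma small_or_large {c : V → ZMod p} (hc : c ∈ hypCode p F V) {M : ℕ}
    (hsl : ShortOrLong F c M) :
    Fintype.card F * #{v : V | c v ≠ 0} ≤ 2 * (M + 1) * Fintype.card V ∨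
      Fintype.card F * #{v : V | c v = 0} ≤ 2 * (M + 1) * Fintype.card V := by
  have h1 := card_support_mul_card_zero_le hc hsl
  have h2 := Finset.card_filter_add_card_filter_not (s := (Finset.univ : Finset V))
    (fun v => c v = 0)
  rw [Finset.card_univ] at h2
  have hpos : 0 < Fintype.card V := Fintype.card_pos
  have aux : ∀ a b h q M : ℕ, 0 < h → a + b = h → b ≤ a → q * (a * b) ≤ h ^ 2 * (M + 1) →
      q * b ≤ 2 * (M + 1) * h := by
    intro a b h q M hh hab hba hq
    have h3 : h * (q * b) ≤ h * (2 * (M + 1) * h) := by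
      nlinarith [Nat.mul_le_mul_left (q * b) (show h ≤ 2 * a by omega)]
    exact Nat.le_of_mul_le_mul_left h3 hh
  rcases le_total #{v : V | c v = 0} #{v : V | c v ≠ 0} with h | h
  · exact Or.inr (aux _ _ _ _ _ hpos (by rw [add_comm]; exact h2) h h1)
  · exact Or.inl (aux _ _ _ _ _ hpos h2 h (by rw [mul_comm #{v : V | c v = 0}]; exact h1))

lemma small_or_large_submodule {c : V → ZMod p} (hc : c ∈ hypCode p F V) {M : ℕ}
    (hsl : ShortOrLong F c M) (H : Submodule F V) :
    Fintype.card F * #{v : V | v ∈ H ∧ c v ≠ 0} ≤ 2 * (M + 1) * #{v : V | v ∈ H} ∨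
      Fintype.card F * #{v : V | v ∈ H ∧ c v = 0} ≤ 2 * (M + 1) * #{v : V | v ∈ H} := by
  have h1 := small_or_large (c := fun v : H => c v) (hypCode_comp hc H.subtype) (M := M)
    (fun u v => hsl u v)
  have h2 : Fintype.card H = #{v : V | v ∈ H} := Fintype.card_subtype _
  have h3 := card_filter_submodule H (fun v => c v ≠ 0)
  have h4 := card_filter_submodule H (fun v => c v = 0)
  rw [h2] at h1
  refine h1.imp (fun h => le_of_eq_of_le ?_ h) (fun h => le_of_eq_of_le ?_ h)
  · congr 1
    convert h3.symm
  · congr 1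
    convert h4.symm

lemma exists_ne_zero_of_support [Fact p.Prime] [CharP F p] {c : V → ZMod p}
    (hc : c ∈ hypCode p F V) (hV : 2 ≤ finrank F V) {v : V} (hv : c v ≠ 0) :
    ∃ w : V, w ≠ 0 ∧ c w ≠ 0 := by
  by_contra! hcon
  have hv0 : v = 0 := by
    by_contra h
    exact hv (hcon v h)
  subst hv0
  have : Nontrivial V := Module.nontrivial_of_finrank_pos (R := F) (by omega)
  obtain ⟨u, hu⟩ := exists_ne (0 : V)
  obtain ⟨w, hw⟩ : ∃ w, w ∉ Submodule.span F {u} := by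
    by_contra! hall
    have h1 : finrank F (Submodule.span F {u}) = finrank F V := by
      rw [(Submodule.eq_top_iff').2 hall, finrank_top]
    rw [finrank_span_singleton hu] at h1
    omega
  have h1 := lineCount_mul_le_planeCount hc u 0 w
  have h2 : lineCount F c u 0 = 1 := by
    have h3 : ({x : F | c (x • u) ≠ 0} : Finset F) = {0} := by
      ext x
      simp only [Finset.mem_filter, Finset.mem_univ, true_and, Finset.mem_singleton]
      refine ⟨fun h => ?_, fun h => by simpa [h] using hv⟩
      by_contra hx
      exact h (hcon _ (smul_ne_zero hx hu))
    simp [lineCount, affineCount, hcon u hu, h3]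
  have h3 : planeCount F c u 0 w = 0 := by
    unfold planeCount
    rw [Finset.card_eq_zero, Finset.filter_eq_empty_iff]
    intro y _
    rw [not_not, smul_zero, add_zero]
    refine hcon _ fun h0 => hw ?_
    rw [eq_neg_of_add_eq_zero_left h0]
    exact Submodule.neg_mem _ (Submodule.smul_mem _ _ (Submodule.mem_span_singleton_self u))
  rw [h2, h3] at h1
  have h4 : 1 < Fintype.card F := Fintype.one_lt_card
  omega

end Dichotomy

/-! ### Removing a hyperplane -/

section Reduction

open scoped Finset

lemma card_filter_and_add_not {V : Type*} [Fintype V] (P Q : V → Prop) :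
    #{v | Q v ∧ P v} + #{v | ¬ Q v ∧ P v} = #{v | P v} := by
  have h := Finset.card_filter_add_card_filter_not (s := ({v | P v} : Finset V)) Q
  rw [Finset.filter_filter, Finset.filter_filter] at h
  simpa only [and_comm] using h

lemma card_filter_and_add_not' {V : Type*} [Fintype V] (P Q : V → Prop) :
    #{v | Q v ∧ P v} + #{v | Q v ∧ ¬ P v} = #{v | Q v} := by
  have h := card_filter_and_add_not Q P
  simpa only [and_comm] using h

lemma exists_card_filter_eq_ge {p : ℕ} [Fact p.Prime] {V : Type*} [Fintype V]
    (c : V → ZMod p) (P : V → Prop) :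
    ∃ α : ZMod p, α ≠ 0 ∧ #{v | P v ∧ c v ≠ 0} ≤ (p - 1) * #{v | P v ∧ c v = α} := by
  have h1 : #{v | P v ∧ c v ≠ 0}
      = ∑ α ∈ Finset.univ.erase (0 : ZMod p), #{v ∈ {v | P v ∧ c v ≠ 0} | c v = α} :=
    Finset.card_eq_sum_card_fiberwise fun v hv => by
      have hv' : P v ∧ c v ≠ 0 := by simpa using hv
      simpa using hv'.2
  have hp : p - 1 = #(Finset.univ.erase (0 : ZMod p)) := by
    rw [Finset.card_erase_of_mem (Finset.mem_univ _), Finset.card_univ, ZMod.card]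
  have hne : (Finset.univ.erase (0 : ZMod p)).Nonempty := by
    rw [← Finset.card_pos, ← hp]
    have := (Fact.out : p.Prime).two_le
    omega
  obtain ⟨α, hα, hmax⟩ := Finset.exists_max_image _
    (fun α => #{v ∈ {v | P v ∧ c v ≠ 0} | c v = α}) hne
  refine ⟨α, Finset.ne_of_mem_erase hα, ?_⟩
  have h2 : #{v | P v ∧ c v = α} = #{v ∈ {v | P v ∧ c v ≠ 0} | c v = α} := by
    rw [Finset.filter_filter]
    congr 1
    ext v
    have := Finset.ne_of_mem_erase hα
    simp only [Finset.mem_filter, Finset.mem_univ, true_and]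
    refine ⟨fun h => ⟨⟨h.1, h.2 ▸ this⟩, h.2⟩, fun h => ⟨h.1.1, h.2⟩⟩
  rw [h1, hp, h2, ← smul_eq_mul]
  exact Finset.sum_le_card_nsmul _ _ _ hmax

variable {p : ℕ} {F V : Type*} [Field F] [AddCommGroup V] [Module F V]

lemma exists_dual_ker_eq [FiniteDimensional F V] {H : Submodule F V}
    (hH : finrank F H + 1 = finrank F V) : ∃ φ : Module.Dual F V, LinearMap.ker φ = H := by
  have hne : H ≠ ⊤ := by
    rintro rfl
    rw [finrank_top] at hH
    omega
  obtain ⟨x, hx⟩ : ∃ x, x ∉ H := by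
    by_contra! h
    exact hne ((Submodule.eq_top_iff').2 h)
  obtain ⟨φ, hφ, hle⟩ := Submodule.exists_le_ker_of_notMem hx
  refine ⟨φ, (Submodule.eq_of_le_of_finrank_eq hle ?_).symm⟩
  have h1 := Module.Dual.finrank_ker_add_one_of_ne_zero (f := φ) (by
    rintro rfl
    exact hφ rfl)
  omega

lemma indicator_mem_hypCode [FiniteDimensional F V] {H : Submodule F V}
    (hH : finrank F H + 1 = finrank F V) (α : ZMod p) :
    (fun v => if v ∈ H then α else 0) ∈ hypCode p F V := by
  obtain ⟨φ, hφ⟩ := exists_dual_ker_eq hH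
  have h1 : (fun v => if v ∈ H then α else 0)
      = α • fun v => if φ v = 0 then (1 : ZMod p) else 0 := by
    funext v
    rw [← hφ]
    simp [LinearMap.mem_ker]
  rw [h1]
  exact Submodule.smul_mem _ _ (Submodule.subset_span ⟨φ, rfl⟩)

variable [Fintype F] [Fintype V]

lemma card_submodule (H : Submodule F V) :
    #{v : V | v ∈ H} = Fintype.card F ^ finrank F H := by
  rw [← Module.card_eq_pow_finrank (K := F) (V := H)]
  exact (Fintype.card_subtype _).symm

/-- A hyperplane containing many support points can be subtracted so as to lower the weight. -/
lemma exists_sub_hyperplane [Fact p.Prime] [CharP F p] {c : V → ZMod p}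
    (hc : c ∈ hypCode p F V) {M : ℕ}
    (hS : Fintype.card F * #{v : V | c v ≠ 0} ≤ M * Fintype.card V)
    (hM : (M + 2) ^ 2 < Fintype.card F) (hM' : 4 * M + 6 < Fintype.card F)
    (hMp : 2 * (M + 2) * p ≤ Fintype.card F)
    {H : Submodule F V} (hH : finrank F H + 1 = finrank F V)
    (hSH : 2 * (M + 1) * #{v | v ∈ H} < Fintype.card F * #{v | v ∈ H ∧ c v ≠ 0}) :
    ∃ α : ZMod p, α ≠ 0 ∧ (fun v => c v - if v ∈ H then α else 0) ∈ hypCode p F V ∧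
      #{v | (c v - if v ∈ H then α else 0) ≠ 0} < #{v | c v ≠ 0} := by
  have hsl : ShortOrLong F c M := shortOrLong_of_card_le hc hS (by nlinarith)
  have hz := (small_or_large_submodule hc hsl H).resolve_left (not_le.2 hSH)
  obtain ⟨α, hα, hN⟩ := exists_card_filter_eq_ge c (fun v => v ∈ H)
  have hcode : (fun v => c v - if v ∈ H then α else 0) ∈ hypCode p F V :=
    Submodule.sub_mem _ hc (indicator_mem_hypCode hH α)
  refine ⟨α, hα, hcode, ?_⟩
  set c' : V → ZMod p := fun v => c v - if v ∈ H then α else 0 with hc'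
  have e1 : #{v | v ∈ H ∧ c v ≠ 0} + #{v | v ∉ H ∧ c v ≠ 0} = #{v | c v ≠ 0} := by
    convert card_filter_and_add_not (fun v => c v ≠ 0) (fun v => v ∈ H)
  have e2 : #{v | v ∈ H ∧ c' v ≠ 0} + #{v | v ∉ H ∧ c' v ≠ 0} = #{v | c' v ≠ 0} := by
    convert card_filter_and_add_not (fun v => c' v ≠ 0) (fun v => v ∈ H)
  have e3 : #{v | v ∈ H ∧ c v = 0} + #{v | v ∈ H ∧ c v ≠ 0} = #{v | v ∈ H} := by
    convert card_filter_and_add_not' (fun v => c v = 0) (fun v => v ∈ H)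
  have e4 : #{v | v ∈ H ∧ c' v = 0} + #{v | v ∈ H ∧ c' v ≠ 0} = #{v | v ∈ H} := by
    convert card_filter_and_add_not' (fun v => c' v = 0) (fun v => v ∈ H)
  have e5 : #{v | v ∉ H ∧ c' v ≠ 0} = #{v | v ∉ H ∧ c v ≠ 0} := by
    congr 1
    ext v
    simp only [Finset.mem_filter, Finset.mem_univ, true_and, hc']
    refine and_congr_right fun h => ?_
    simp [h]
  have e6 : #{v | v ∈ H ∧ c' v = 0} = #{v | v ∈ H ∧ c v = α} := by
    congr 1
    ext v
    simp only [Finset.mem_filter, Finset.mem_univ, true_and, hc']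
    refine and_congr_right fun h => ?_
    simp [h, sub_eq_zero]
  have e7 : Fintype.card V = Fintype.card F * #{v | v ∈ H} := by
    rw [card_submodule, ← pow_succ', hH]
    exact Module.card_eq_pow_finrank
  have hp := (Fact.out : p.Prime).two_le
  have hHpos : 0 < #{v | v ∈ H} := Finset.card_pos.2 ⟨0, by simp⟩
  change #{v | c' v ≠ 0} < _
  have hd : Fintype.card F * #{v | c' v ≠ 0} ≤ (M + 1) * Fintype.card V →
      Fintype.card F * #{v | v ∈ H ∧ c' v ≠ 0} ≤ 2 * (M + 1 + 1) * #{v | v ∈ H} ∨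
      Fintype.card F * #{v | v ∈ H ∧ c v = α} ≤ 2 * (M + 1 + 1) * #{v | v ∈ H} := fun h =>
    e6 ▸ small_or_large_submodule hcode (shortOrLong_of_card_le hcode h (by nlinarith)) H
  rw [e6] at e4
  rw [e5] at e2
  rw [e7] at hS hd
  generalize #{v | v ∉ H ∧ c v ≠ 0} = o at e1 e2
  generalize #{v | c' v ≠ 0} = S' at e2 hd ⊢
  generalize #{v | c v ≠ 0} = S at e1 hS ⊢
  generalize #{v | v ∈ H ∧ c v ≠ 0} = s at e1 hSH e3 hN
  generalize #{v | v ∈ H ∧ c v = 0} = z at hz e3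
  generalize #{v | v ∈ H ∧ c v = α} = N at e4 hN hd
  generalize #{v | v ∈ H ∧ c' v ≠ 0} = s' at e4 e2 hd
  generalize #{v | v ∈ H} = k at *
  generalize Fintype.card F = q at *
  have hS' : q * S' ≤ (M + 1) * (q * k) := by
    have h1 : S' ≤ S + z := by omega
    have h2 : 2 * (M + 1) * k ≤ q * k := Nat.mul_le_mul_right _ (by omega)
    calc q * S' ≤ q * S + q * z := by
          rw [← mul_add]
          exact Nat.mul_le_mul_left _ h1
      _ ≤ M * (q * k) + q * k := Nat.add_le_add hS (hz.trans h2)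
      _ = (M + 1) * (q * k) := by ring
  have e3' : q * z + q * s = q * k := by rw [← mul_add, ← e3]
  rcases hd hS' with h | h
  · have h0 : (4 * M + 6) * k < q * k := Nat.mul_lt_mul_of_pos_right hM' hHpos
    have h1 : q * s' < q * s := by nlinarith
    have := lt_of_mul_lt_mul_left h1 (Nat.zero_le _)
    omega
  · exfalso
    obtain ⟨r, rfl⟩ : ∃ r, p = r + 1 := ⟨p - 1, by omega⟩
    rw [Nat.add_sub_cancel] at hN
    have h1 : q * s ≤ r * (2 * (M + 1 + 1) * k) := by
      calc q * s ≤ q * (r * N) := Nat.mul_le_mul_left _ hN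
        _ = r * (q * N) := by ring
        _ ≤ _ := Nat.mul_le_mul_left _ h
    have h2 : 2 * (M + 2) * (r + 1) * k ≤ q * k := Nat.mul_le_mul_right _ hMp
    nlinarith

end Reduction

/-! ### Long lines through a support point -/

section Cylinder

open scoped Finset

/-- The number of support points of `c` on the fibre over `v`. -/
def fibreCount {p : ℕ} {F W : Type*} [Fintype F] (c : W × F → ZMod p) (v : W) : ℕ :=
  #{x : F | c (v, x) ≠ 0}

lemma sum_fibreCount {p : ℕ} {F W : Type*} [Fintype F] [Fintype W]
    (c : W × F → ZMod p) (P : W → Prop) :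
    ∑ v with P v, fibreCount c v = #{x : W × F | P x.1 ∧ c x ≠ 0} := by
  unfold fibreCount
  simp_rw [Finset.card_filter]
  rw [Fintype.sum_prod_type, Finset.sum_filter]
  refine Finset.sum_congr rfl fun v _ => ?_
  by_cases h : P v <;> simp [h]

variable {p : ℕ} {F W : Type*} [Field F] [Fintype F] [AddCommGroup W] [Module F W]

/-- The nonzero `v` whose fibre misses at most `M + 1` points of the support. -/
def LongFibre (c : W × F → ZMod p) (M : ℕ) (v : W) : Prop :=
  v ≠ 0 ∧ Fintype.card F ≤ fibreCount c v + (M + 1)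

lemma fibreCount_eq (c : W × F → ZMod p) (v : W) :
    fibreCount c v = affineCount F c (0, 1) (v, 0) := by
  simp [fibreCount, affineCount]

lemma fibreCount_smul {c : W × F → ZMod p} (hc : c ∈ hypCode p F (W × F)) {t : F} (ht : t ≠ 0)
    (v : W) : fibreCount c (t • v) = fibreCount c v := by
  symm
  refine Finset.card_bij (fun x _ => t * x) ?_ ?_ ?_
  · intro x hx
    have h : c (t • (v, x)) = c (v, x) := hypCode_smul hc ht _
    simp only [Finset.mem_filter, Finset.mem_univ, true_and] at hx ⊢
    rw [← h] at hx
    simpa using hx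
  · intro x _ y _ h
    exact mul_left_cancel₀ ht h
  · intro y hy
    simp only [Finset.mem_filter, Finset.mem_univ, true_and] at hy
    refine ⟨t⁻¹ * y, ?_, by field_simp⟩
    have h : c (t • (v, t⁻¹ * y)) = c (v, t⁻¹ * y) := hypCode_smul hc ht _
    simp only [Finset.mem_filter, Finset.mem_univ, true_and]
    rw [← h]
    simpa [ht] using hy

lemma LongFibre.smul {c : W × F → ZMod p} (hc : c ∈ hypCode p F (W × F)) {M : ℕ} {v : W}
    (hv : LongFibre c M v) {t : F} (ht : t ≠ 0) : LongFibre c M (t • v) :=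
  ⟨smul_ne_zero ht hv.1, by rw [fibreCount_smul hc ht]; exact hv.2⟩

variable [Fintype W]

lemma card_pow_le_card_longFibre [Fact p.Prime] [CharP F p] {c : W × F → ZMod p}
    (hc : c ∈ hypCode p F (W × F)) {M : ℕ} (hsl : ShortOrLong F c M)
    (hM : M ^ 2 < Fintype.card F) (h1 : c (0, 1) ≠ 0) {n : ℕ} (hn : finrank F W = n + 1) :
    Fintype.card F ^ n ≤ #{v : W | LongFibre c M v} + 1 := by
  by_cases hall : ∀ v : W, v ≠ 0 → LongFibre c M v
  · have h2 : ({v : W | LongFibre c M v} : Finset W) = Finset.univ.erase 0 := by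
      ext v
      simpa using ⟨fun h => h.1, hall v⟩
    rw [h2, Finset.card_erase_add_one (Finset.mem_univ _), Finset.card_univ,
      Module.card_eq_pow_finrank (K := F) (V := W), hn]
    exact Nat.pow_le_pow_right Fintype.card_pos (Nat.le_succ n)
  · push Not at hall
    obtain ⟨v₀, hv₀, hlong⟩ := hall
    have hquot : Fintype.card (W ⧸ F ∙ v₀) = Fintype.card F ^ n := by
      rw [Module.card_eq_pow_finrank (K := F)]
      have h3 := Submodule.finrank_quotient_add_finrank (F ∙ v₀)
      rw [finrank_span_singleton hv₀, hn] at h3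
      congr 1
      omega
    rw [← hquot, ← Finset.card_univ, ← Finset.card_erase_add_one (Finset.mem_univ (0 : W ⧸ F ∙ v₀))]
    refine Nat.add_le_add_right
      (Finset.card_le_card_of_surjOn (Submodule.mkQ (F ∙ v₀)) fun y hy => ?_) 1
    have hy0 : y ≠ 0 := by simpa using hy
    obtain ⟨u, rfl⟩ := Submodule.mkQ_surjective _ y
    obtain ⟨a, b, hab, hab'⟩ := exists_long_line hc hsl hM h1 (v₀, 0) (u, 0)
    have h3 : Fintype.card F ≤ fibreCount c (a • v₀ + b • u) + (M + 1) := by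
      rw [fibreCount_eq]
      simp only [lineCount, h1, ne_eq, not_false_eq_true, if_true, Prod.smul_mk, smul_zero,
        Prod.mk_add_mk, add_zero] at hab'
      omega
    have hb : b ≠ 0 := by
      rintro rfl
      have ha : a ≠ 0 := by simpa using hab
      rw [zero_smul, add_zero, fibreCount_smul hc ha] at h3
      exact hlong ⟨hv₀, h3⟩
    have h4 : b⁻¹ • (a • v₀ + b • u) = (b⁻¹ * a) • v₀ + u := by
      rw [smul_add, smul_smul, smul_smul, inv_mul_cancel₀ hb, one_smul]
    rw [← fibreCount_smul hc (inv_ne_zero hb), h4] at h3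
    have h5 : Submodule.mkQ (F ∙ v₀) ((b⁻¹ * a) • v₀ + u) = Submodule.mkQ (F ∙ v₀) u := by
      rw [map_add, add_eq_right]
      simp
    refine ⟨(b⁻¹ * a) • v₀ + u, ?_, h5⟩
    simp only [Finset.coe_filter, Finset.mem_univ, true_and, Set.mem_ofPred_eq]
    refine ⟨fun h0 => hy0 ?_, h3⟩
    rw [← h5, h0, map_zero]

/-- A cylinder over a hyperplane with many long fibres contains many support points. -/
lemma cylinder_support_large {c : W × F → ZMod p} {M : ℕ} (A : Submodule F W)
    (hA : 2 * (M + 1) * #{v | v ∈ A} <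
      #{v | v ∈ A ∧ LongFibre c M v} * (Fintype.card F - (M + 1))) :
    2 * (M + 1) * #{x : W × F | x.1 ∈ A} <
      Fintype.card F * #{x : W × F | x.1 ∈ A ∧ c x ≠ 0} := by
  have h1 : #{x : W × F | x.1 ∈ A} = Fintype.card F * #{v | v ∈ A} := by
    rw [mul_comm, ← Finset.card_univ, ← Finset.card_product]
    congr 1
    ext x
    simp
  have h2 : #{v | v ∈ A ∧ LongFibre c M v} * (Fintype.card F - (M + 1)) ≤
      #{x : W × F | x.1 ∈ A ∧ c x ≠ 0} := by
    rw [← sum_fibreCount c (fun v => v ∈ A), ← smul_eq_mul]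
    refine (Finset.card_nsmul_le_sum _ _ _ fun v hv => ?_).trans
      (Finset.sum_le_sum_of_subset (f := fibreCount c)
        (Finset.monotone_filter_right _ fun v _ hv => hv.1))
    have h3 : v ∈ A ∧ LongFibre c M v := by simpa using hv
    have h4 := h3.2.2
    omega
  rw [h1, mul_left_comm]
  exact Nat.mul_lt_mul_of_pos_left (hA.trans_le h2) Fintype.card_pos

lemma card_mul_sum_dual [Fintype (Module.Dual F W)] (f : F → ℕ) {v : W} (hv : v ≠ 0) :
    Fintype.card F * ∑ l : Module.Dual F W, f (l v) =
      Fintype.card (Module.Dual F W) * ∑ x, f x := by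
  obtain ⟨m, hm⟩ := Projective.exists_dual_eq_one F hv
  have h1 : ∀ x : F, ∑ l : Module.Dual F W, f (l v + x) = ∑ l : Module.Dual F W, f (l v) := by
    intro x
    rw [← Equiv.sum_comp (Equiv.addRight (x • m)) fun l : Module.Dual F W => f (l v)]
    simp [hm]
  have h2 : ∀ y : F, ∑ x, f (y + x) = ∑ x, f x := fun y => Equiv.sum_comp (Equiv.addLeft y) f
  calc Fintype.card F * ∑ l : Module.Dual F W, f (l v)
      = ∑ x : F, ∑ l : Module.Dual F W, f (l v + x) := by
        rw [Finset.sum_congr rfl fun x _ => h1 x, Finset.sum_const, Finset.card_univ, smul_eq_mul]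
    _ = ∑ l : Module.Dual F W, ∑ x, f (l v + x) := Finset.sum_comm
    _ = _ := by
        rw [Finset.sum_congr rfl fun l _ => h2 (l v), Finset.sum_const, Finset.card_univ,
          smul_eq_mul]

lemma exists_section [Fintype (Module.Dual F W)] {c : W × F → ZMod p}
    (hc : c ∈ hypCode p F (W × F)) (h1 : c (0, 1) ≠ 0) {M : ℕ}
    (hS : Fintype.card F * #{x : W × F | c x ≠ 0} ≤ M * Fintype.card (W × F))
    (hM : 4 * (M + 1) ^ 2 ≤ Fintype.card F) (hT : 0 < #{v | LongFibre c M v}) :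
    ∃ l : Module.Dual F W, Fintype.card F * #{v | c (v, l v) ≠ 0} ≤ (M + 1) * Fintype.card W ∧
      4 * #{v | LongFibre c M v ∧ c (v, l v) = 0} ≤ #{v | LongFibre c M v} := by
  have hX : Fintype.card F * ∑ l : Module.Dual F W, #{v | c (v, l v) ≠ 0} ≤
      Fintype.card (Module.Dual F W) * #{x : W × F | c x ≠ 0} := by
    have h2 : #{x : W × F | c x ≠ 0} = ∑ v, fibreCount c v := by
      simpa using (sum_fibreCount c (fun _ => True)).symm
    rw [h2]
    simp_rw [Finset.card_filter]
    rw [Finset.sum_comm, Finset.mul_sum, Finset.mul_sum]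
    refine Finset.sum_le_sum fun v _ => ?_
    by_cases hv : v = 0
    · subst hv
      by_cases h0 : c (0, 0) = 0
      · simp [h0]
      · have h3 : fibreCount c (0 : W) = Fintype.card F := by
          rw [fibreCount, ← Finset.card_univ]
          congr 1
          rw [Finset.filter_eq_self]
          intro x _
          by_cases hx : x = 0
          · rwa [hx]
          · have h4 : c (x • (0, 1)) = c (0, 1) := hypCode_smul hc hx _
            rw [← h4] at h1
            simpa using h1
        simp [h0, h3, mul_comm]
    · rw [card_mul_sum_dual (fun x => if c (v, x) ≠ 0 then 1 else 0) hv, fibreCount,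
        Finset.card_filter]
  have hB : Fintype.card F * ∑ l : Module.Dual F W, #{v | LongFibre c M v ∧ c (v, l v) = 0} ≤
      Fintype.card (Module.Dual F W) * (#{v | LongFibre c M v} * (M + 1)) := by
    simp_rw [← Finset.filter_filter, Finset.card_filter _ (Finset.filter _ _)]
    rw [Finset.sum_comm, Finset.mul_sum, ← smul_eq_mul #{v | LongFibre c M v},
      ← Finset.sum_const, Finset.mul_sum]
    refine Finset.sum_le_sum fun v hv => ?_
    have hv' : LongFibre c M v := by simpa using hv
    rw [card_mul_sum_dual (fun x => if c (v, x) = 0 then 1 else 0) hv'.1]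
    refine Nat.mul_le_mul_left _ ?_
    rw [← Finset.card_filter]
    have h3 : #{x | c (v, x) = 0} + #{x | c (v, x) ≠ 0} = Fintype.card F := by
      rw [← Finset.card_univ]
      convert Finset.card_filter_add_card_filter_not (s := (Finset.univ : Finset F))
        (fun x => c (v, x) = 0)
    have h4 := hv'.2
    rw [fibreCount] at h4
    omega
  by_contra! hcon
  have hall : ∀ l : Module.Dual F W, (M + 1) * Fintype.card W * #{v | LongFibre c M v} <
      #{v | LongFibre c M v} * (Fintype.card F * #{v | c (v, l v) ≠ 0}) +
      4 * ((M + 1) * Fintype.card W) * #{v | LongFibre c M v ∧ c (v, l v) = 0} := by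
    intro l
    have hW : 0 < (M + 1) * Fintype.card W := Nat.mul_pos (Nat.succ_pos _) Fintype.card_pos
    rcases le_or_gt (Fintype.card F * #{v | c (v, l v) ≠ 0}) ((M + 1) * Fintype.card W) with h | h
    · have := Nat.mul_lt_mul_of_pos_left (hcon l h) hW
      refine lt_of_lt_of_le (lt_of_lt_of_eq this ?_) (Nat.le_add_left _ _)
      ring
    · refine lt_of_lt_of_le ?_ (Nat.le_add_right _ _)
      rw [mul_comm]
      exact Nat.mul_lt_mul_of_pos_left h hT
  have hsum := Finset.sum_lt_sum_of_nonempty (s := (Finset.univ : Finset (Module.Dual F W)))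
    Finset.univ_nonempty (fun l _ => hall l)
  rw [Finset.sum_const, Finset.card_univ, smul_eq_mul, Finset.sum_add_distrib, ← Finset.mul_sum,
    ← Finset.mul_sum, ← Finset.mul_sum] at hsum
  rw [Fintype.card_prod] at hS
  have hL : 0 < Fintype.card (Module.Dual F W) := Fintype.card_pos
  have hW : 0 < Fintype.card W := Fintype.card_pos
  have hq : 0 < Fintype.card F := Fintype.card_pos
  have hS' : #{x : W × F | c x ≠ 0} ≤ M * Fintype.card W :=
    Nat.le_of_mul_le_mul_left (by linarith) hq
  generalize ∑ l : Module.Dual F W, #{v | c (v, l v) ≠ 0} = X at *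
  generalize ∑ l : Module.Dual F W, #{v | LongFibre c M v ∧ c (v, l v) = 0} = B at *
  generalize #{v | LongFibre c M v} = t at *
  generalize #{x : W × F | c x ≠ 0} = S at *
  generalize Fintype.card (Module.Dual F W) = L at *
  generalize Fintype.card F = q at *
  generalize Fintype.card W = w at *
  have e1 : t * (q * X) ≤ t * (L * (M * w)) :=
    Nat.mul_le_mul_left _ (hX.trans (Nat.mul_le_mul_left _ hS'))
  have e2 : L * w * t < 4 * ((M + 1) * w) * B := by nlinarith
  have e3 : q * (L * w * t) < q * (4 * ((M + 1) * w) * B) := Nat.mul_lt_mul_of_pos_left e2 hq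
  have e4 : 4 * ((M + 1) * w) * (q * B) ≤ 4 * ((M + 1) * w) * (L * (t * (M + 1))) :=
    Nat.mul_le_mul_left _ hB
  have e5 : 4 * (M + 1) ^ 2 * (L * w * t) ≤ q * (L * w * t) := Nat.mul_le_mul_right _ hM
  nlinarith

end Cylinder

/-! ### Sums of few hyperplanes -/

section HyperplaneSum

open scoped Finset

/-- `c` is a linear combination of at most `M` hyperplanes. -/
def IsHypSum {p : ℕ} (F : Type*) {V : Type*} [Field F] [AddCommGroup V] [Module F V]
    (c : V → ZMod p) (M : ℕ) : Prop :=
  ∃ a : Submodule F V →₀ ZMod p, #a.support ≤ M ∧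
    (∀ H ∈ a.support, finrank F H + 1 = finrank F V) ∧
    ∀ v, c v = ∑ H ∈ a.support, if v ∈ H then a H else 0

variable {p : ℕ} {F V : Type*} [Field F] [AddCommGroup V] [Module F V]

lemma IsHypSum.of_sub {c : V → ZMod p} {M : ℕ} {H : Submodule F V} {α : ZMod p}
    (hH : finrank F H + 1 = finrank F V)
    (hc : IsHypSum F (fun v => c v - if v ∈ H then α else 0) M) : IsHypSum F c (M + 1) := by
  obtain ⟨a, haM, haH, hac⟩ := hc
  have hsub : (a + Finsupp.single H α).support ⊆ insert H a.support := by
    refine Finsupp.support_add.trans ?_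
    rw [Finset.insert_eq, Finset.union_comm]
    exact Finset.union_subset_union_left Finsupp.support_single_subset
  refine ⟨a + Finsupp.single H α, ?_, ?_, fun v => ?_⟩
  · exact (Finset.card_le_card hsub).trans ((Finset.card_insert_le _ _).trans (by omega))
  · intro K hK
    rcases Finset.mem_insert.1 (hsub hK) with rfl | h
    · exact hH
    · exact haH K h
  · have h1 : ∀ b : Submodule F V →₀ ZMod p, b.support ⊆ insert H a.support →
        ∑ K ∈ b.support, (if v ∈ K then b K else 0) =
          ∑ K ∈ insert H a.support, if v ∈ K then b K else 0 := fun b hb =>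
      Finset.sum_subset hb fun K _ hK => by simp [Finsupp.notMem_support_iff.1 hK]
    have h2 : ∑ K ∈ insert H a.support, (if v ∈ K then Finsupp.single H α K else 0)
        = if v ∈ H then α else 0 := by
      rw [Finset.sum_eq_single_of_mem H (Finset.mem_insert_self _ _)]
      · simp
      · intro K _ hK
        simp [Finsupp.single_eq_of_ne hK]
    have h3 := hac v
    rw [h1 a (Finset.subset_insert _ _)] at h3
    rw [h1 _ hsub, eq_add_of_sub_eq h3, ← h2, ← Finset.sum_add_distrib]
    refine Finset.sum_congr rfl fun K _ => ?_
    split_ifs <;> simp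

variable [Fintype F] [Fintype V]

lemma card_submodule_of_hyperplane {H : Submodule F V} (hH : finrank F H + 1 = finrank F V) :
    Fintype.card F * #{v : V | v ∈ H} = Fintype.card V := by
  rw [card_submodule, ← pow_succ', hH]
  exact Module.card_eq_pow_finrank.symm

lemma card_inf_hyperplane_le {H K : Submodule F V} (hH : finrank F H + 1 = finrank F V)
    (hK : finrank F K + 1 = finrank F V) (hHK : H ≠ K) :
    Fintype.card F ^ 2 * #{v : V | v ∈ H ⊓ K} ≤ Fintype.card V := by
  have hlt : finrank F ↥(H ⊓ K) < finrank F H := by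
    refine Submodule.finrank_lt_finrank_of_lt (inf_le_left.lt_of_ne fun h => hHK ?_)
    exact Submodule.eq_of_le_of_finrank_eq (inf_eq_left.1 h) (by omega)
  rw [card_submodule, ← pow_add, Module.card_eq_pow_finrank (K := F) (V := V)]
  exact Nat.pow_le_pow_right Fintype.card_pos (by omega)

lemma card_support_hypSum_ge {c : V → ZMod p} {a : Submodule F V →₀ ZMod p}
    (haH : ∀ H ∈ a.support, finrank F H + 1 = finrank F V)
    (hac : ∀ v, c v = ∑ H ∈ a.support, if v ∈ H then a H else 0) :
    #a.support * ((Fintype.card F + 1 - #a.support) * Fintype.card V) ≤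
      Fintype.card F ^ 2 * #{v : V | c v ≠ 0} := by
  set q := Fintype.card F with hq
  set E : Submodule F V → Finset V := fun H => {v | v ∈ H ∧ ∀ K ∈ a.support, v ∈ K → K = H}
    with hE
  have h1 : ∀ H ∈ a.support, (q + 1 - #a.support) * Fintype.card V ≤ q ^ 2 * #(E H) := by
    intro H hH
    have h2 : ({v | v ∈ H} : Finset V) ⊆
        E H ∪ (a.support.erase H).biUnion fun K => ({v | v ∈ H ⊓ K} : Finset V) := by
      intro v hv
      have hv' : v ∈ H := by simpa using hv
      rw [Finset.mem_union, Finset.mem_biUnion]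
      by_cases h : ∀ K ∈ a.support, v ∈ K → K = H
      · exact Or.inl (by simpa [hE, hv'] using h)
      · push Not at h
        obtain ⟨K, hK, hvK, hne⟩ := h
        exact Or.inr ⟨K, Finset.mem_erase.2 ⟨hne, hK⟩, by simp [hv', hvK]⟩
    have h3 : #{v : V | v ∈ H} ≤ #(E H) + ∑ K ∈ a.support.erase H, #{v : V | v ∈ H ⊓ K} :=
      (Finset.card_le_card h2).trans ((Finset.card_union_le _ _).trans
        (Nat.add_le_add_left Finset.card_biUnion_le _))
    have h4 : q ^ 2 * ∑ K ∈ a.support.erase H, #{v : V | v ∈ H ⊓ K} ≤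
        (#a.support - 1) * Fintype.card V := by
      rw [Finset.mul_sum, ← Finset.card_erase_of_mem hH, ← smul_eq_mul]
      refine Finset.sum_le_card_nsmul _ _ _ fun K hK => ?_
      rw [Finset.mem_erase] at hK
      exact card_inf_hyperplane_le (haH H hH) (haH K hK.2) hK.1.symm
    have h5 := card_submodule_of_hyperplane (haH H hH)
    have h6 : 0 < #a.support := Finset.card_pos.2 ⟨H, hH⟩
    have h7 : q + 1 - #a.support = q - (#a.support - 1) := by omega
    have h8 := Nat.mul_le_mul_left (q ^ 2) h3
    rw [h7, Nat.sub_mul, Nat.sub_le_iff_le_add, ← h5]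
    rw [← h5] at h4
    rw [← hq] at *
    nlinarith
  have h2 : ∑ H ∈ a.support, #(E H) ≤ #{v : V | c v ≠ 0} := by
    rw [← Finset.card_biUnion]
    · refine Finset.card_le_card fun v hv => ?_
      rw [Finset.mem_biUnion] at hv
      obtain ⟨H, hH, hv⟩ := hv
      simp only [hE, Finset.mem_filter, Finset.mem_univ, true_and] at hv
      rw [Finset.mem_filter, hac, Finset.sum_eq_single_of_mem H hH, if_pos hv.1]
      · exact ⟨Finset.mem_univ _, Finsupp.mem_support_iff.1 hH⟩
      · intro K hK hne
        exact if_neg fun h => hne (hv.2 K hK h)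
    · intro H hH K hK hne
      rw [Function.onFun, Finset.disjoint_left]
      intro v hv hv'
      simp only [hE, Finset.mem_filter, Finset.mem_univ, true_and] at hv hv'
      exact hne (hv'.2 H hH hv.1)
  refine le_trans ?_ (Nat.mul_le_mul_left _ h2)
  rw [Finset.mul_sum, ← smul_eq_mul #a.support]
  exact Finset.card_nsmul_le_sum _ _ _ h1

lemma IsHypSum.of_succ {c : V → ZMod p} {M : ℕ} (hc : IsHypSum F c (M + 1))
    (hS : Fintype.card F * #{v : V | c v ≠ 0} ≤ M * Fintype.card V)
    (hM : M * (M + 1) < Fintype.card F) : IsHypSum F c M := by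
  obtain ⟨a, haM, haH, hac⟩ := hc
  refine ⟨a, ?_, haH, hac⟩
  by_contra! hlt
  have hk : #a.support = M + 1 := by omega
  have h1 := card_support_hypSum_ge haH hac
  rw [hk, Nat.add_sub_add_right] at h1
  have hV : 0 < Fintype.card V := Fintype.card_pos
  obtain ⟨r, hr⟩ := Nat.exists_eq_add_of_le (show M ≤ Fintype.card F by nlinarith)
  rw [hr] at h1 hS hM
  rw [Nat.add_sub_cancel_left] at h1
  have h2 : (M + 1) * r * Fintype.card V ≤ (M + r) * M * Fintype.card V := by
    calc (M + 1) * r * Fintype.card V = (M + 1) * (r * Fintype.card V) := by ring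
      _ ≤ (M + r) * ((M + r) * #{v : V | c v ≠ 0}) := by
        linarith
      _ ≤ (M + r) * (M * Fintype.card V) := Nat.mul_le_mul_left _ hS
      _ = _ := by ring
  have h3 := Nat.le_of_mul_le_mul_right h2 hV
  nlinarith

lemma lt_mul_of_card_bounds {q Q M r t T g b : ℕ} (hq : 32 ≤ q) (hr : q = M + 1 + r)
    (hM : 4 * (M + 1) ^ 2 ≤ q) (hT : Q ≤ T + 1) (hQ : q ^ 2 ≤ Q) (hgb : b + g = T)
    (hb : 4 * b ≤ T) (hg : g ≤ (M + 1) * t) : 2 * (M + 1) * Q < t * r := by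
  have h1 : 3 * Q ≤ 4 * (M + 1) * t + 3 := by linarith
  have h2 : 7 * q ≤ 8 * r := by
    rcases Nat.eq_zero_or_pos M with h | h
    · omega
    · nlinarith
  have h3 : 8 * (M + 1) ^ 2 * Q ≤ 2 * q * Q := Nat.mul_le_mul_right _ (by omega)
  have h4 : 1024 ≤ Q := by nlinarith
  by_contra! hcon
  have h5 : 4 * (M + 1) * (t * r) ≤ 4 * (M + 1) * (2 * (M + 1) * Q) := Nat.mul_le_mul_left _ hcon
  have h6 : 3 * Q * r ≤ (4 * (M + 1) * t + 3) * r := Nat.mul_le_mul_right _ h1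
  have h7 : 7 * q * Q ≤ 8 * r * Q := Nat.mul_le_mul_right _ h2
  have h8 : q * 1024 ≤ q * Q := Nat.mul_le_mul_left _ h4
  linarith

lemma exists_cylinder {W : Type*} [AddCommGroup W] [Module F W] [Fintype W] [Fact p.Prime]
    [CharP F p] {c : W × F → ZMod p} (hc : c ∈ hypCode p F (W × F)) {M n : ℕ}
    (hW : finrank F W = n + 2) (h1 : c (0, 1) ≠ 0)
    (hS : Fintype.card F * #{x : W × F | c x ≠ 0} ≤ M * Fintype.card (W × F))
    (hq : 32 ≤ Fintype.card F) (hM : 4 * M ^ 2 ≤ Fintype.card F)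
    (hM' : 0 < n → 4 * (M + 1) ^ 2 ≤ Fintype.card F)
    (ih : 0 < n → ∀ c' ∈ hypCode p F W,
      Fintype.card F * #{v : W | c' v ≠ 0} ≤ (M + 1) * Fintype.card W → IsHypSum F c' (M + 1)) :
    ∃ A : Submodule F W, finrank F A + 1 = finrank F W ∧
      2 * (M + 1) * #{x : W × F | x.1 ∈ A} <
        Fintype.card F * #{x : W × F | x.1 ∈ A ∧ c x ≠ 0} := by
  have hsl : ShortOrLong F c M := shortOrLong_of_card_le hc hS (by nlinarith)
  have hT := card_pow_le_card_longFibre hc hsl (by nlinarith) h1 hW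
  have hM8 : 8 * M ≤ Fintype.card F := by
    rcases le_or_gt M 1 with h | h
    · omega
    · nlinarith
  obtain ⟨r, hr⟩ := Nat.exists_eq_add_of_le (show M + 1 ≤ Fintype.card F by omega)
  suffices h : ∃ A : Submodule F W, finrank F A + 1 = finrank F W ∧
      2 * (M + 1) * Fintype.card F ^ (n + 1) <
        #{v | v ∈ A ∧ LongFibre c M v} * (Fintype.card F - (M + 1)) by
    obtain ⟨A, hA, hlt⟩ := h
    refine ⟨A, hA, cylinder_support_large A ?_⟩
    rwa [card_submodule, show finrank F A = n + 1 by omega]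
  rcases Nat.eq_zero_or_pos n with rfl | hn
  · obtain ⟨v, hv⟩ : ∃ v, LongFibre c M v := by
      by_contra! h
      simp [h] at hT
      omega
    have h2 : finrank F (F ∙ v) = 1 := finrank_span_singleton hv.1
    refine ⟨F ∙ v, by omega, ?_⟩
    have h3 : ({w | w ∈ F ∙ v ∧ LongFibre c M w} : Finset W) =
        ({w | w ∈ F ∙ v} : Finset W).erase 0 := by
      ext w
      simp only [Finset.mem_filter, Finset.mem_univ, true_and, Finset.mem_erase]
      refine ⟨fun h => ⟨h.2.1, h.1⟩, fun h => ⟨h.2, ?_⟩⟩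
      obtain ⟨t, rfl⟩ := Submodule.mem_span_singleton.1 h.2
      exact hv.smul hc fun h0 => h.1 (by simp [h0])
    rw [h3, Finset.card_erase_of_mem (by simp), card_submodule, h2, hr, Nat.add_sub_cancel_left]
    rw [hr] at hM8 hq
    rw [zero_add, pow_one, show M + 1 + r - 1 = M + r by omega]
    nlinarith
  · have : Finite (Module.Dual F W) := Module.finite_of_finite F
    have := Fintype.ofFinite (Module.Dual F W)
    have hM' := hM' hn
    have hpow : Fintype.card F ^ 2 ≤ Fintype.card F ^ (n + 1) :=
      Nat.pow_le_pow_right Fintype.card_pos (by omega)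
    have hTpos : 0 < #{v | LongFibre c M v} := by nlinarith
    obtain ⟨l, hl, hl'⟩ := exists_section hc h1 hS hM' hTpos
    obtain ⟨a, haM, haH, hac⟩ := ih hn (fun v => c (v, l v))
      (hypCode_comp hc (LinearMap.id.prod l)) hl
    have e1 : #{v | LongFibre c M v ∧ c (v, l v) = 0} + #{v | LongFibre c M v ∧ c (v, l v) ≠ 0}
        = #{v | LongFibre c M v} := by
      convert card_filter_and_add_not' (fun v => c (v, l v) = 0) (LongFibre c M)
    have h2 : #{v | LongFibre c M v ∧ c (v, l v) ≠ 0} ≤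
        ∑ A ∈ a.support, #{v | v ∈ A ∧ LongFibre c M v} := by
      refine (Finset.card_le_card fun v hv => ?_).trans Finset.card_biUnion_le
      simp only [Finset.mem_filter, Finset.mem_univ, true_and] at hv
      obtain ⟨A, hA, hvA⟩ := Finset.exists_ne_zero_of_sum_ne_zero ((hac v).symm.trans_ne hv.2)
      rw [Finset.mem_biUnion]
      refine ⟨A, hA, ?_⟩
      have : v ∈ A := by
        by_contra h
        exact hvA (if_neg h)
      simp [this, hv.1]
    have hne : a.support.Nonempty := by
      by_contra! h
      rw [h, Finset.sum_empty] at h2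
      omega
    obtain ⟨A, hA, hmax⟩ := Finset.exists_max_image _
      (fun A => #{v | v ∈ A ∧ LongFibre c M v}) hne
    refine ⟨A, haH A hA, ?_⟩
    have h3 := h2.trans ((Finset.sum_le_card_nsmul _ _ _ hmax).trans
      (Nat.mul_le_mul_right _ haM))
    rw [hr, Nat.add_sub_cancel_left, ← hr]
    exact lt_mul_of_card_bounds hq hr hM' hT hpow e1 hl' h3

lemma exists_rich_hyperplane [Fact p.Prime] [CharP F p] {c : V → ZMod p}
    (hc : c ∈ hypCode p F V) {M n : ℕ} (hV : finrank F V = n + 3) {w₀ : V} (hw₀ : w₀ ≠ 0)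
    (hcw₀ : c w₀ ≠ 0)
    (hS : Fintype.card F * #{v : V | c v ≠ 0} ≤ M * Fintype.card V)
    (hq : 32 ≤ Fintype.card F) (hM : 4 * M ^ 2 ≤ Fintype.card F)
    (hM' : 0 < n → 4 * (M + 1) ^ 2 ≤ Fintype.card F)
    (ih : 0 < n → ∀ W : Submodule F V, finrank F W = n + 2 → ∀ c' ∈ hypCode p F W,
      Fintype.card F * #{v : W | c' v ≠ 0} ≤ (M + 1) * Fintype.card W → IsHypSum F c' (M + 1)) :
    ∃ H : Submodule F V, finrank F H + 1 = finrank F V ∧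
      2 * (M + 1) * #{v | v ∈ H} < Fintype.card F * #{v | v ∈ H ∧ c v ≠ 0} := by
  obtain ⟨W, hW⟩ := Submodule.exists_isCompl (F ∙ w₀)
  set e : (W × F) ≃ₗ[F] V :=
    ((LinearEquiv.refl F W).prodCongr (LinearEquiv.toSpanNonzeroSingleton F V w₀ hw₀)).trans
      (Submodule.prodEquivOfIsCompl W (F ∙ w₀) hW.symm) with he
  have he1 : e (0, 1) = w₀ := by simp [he]
  have hfin : finrank F W = n + 2 := by
    have h := e.finrank_eq
    rw [Module.finrank_prod, Module.finrank_self, hV] at h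
    omega
  have hS' : Fintype.card F * #{x : W × F | (c ∘ e.toLinearMap) x ≠ 0}
      ≤ M * Fintype.card (W × F) := by
    rw [Fintype.card_congr e.toEquiv]
    convert hS using 2
    exact Finset.card_equiv e.toEquiv (by simp)
  obtain ⟨A, hA, hlt⟩ := exists_cylinder (hypCode_comp hc e.toLinearMap) hfin (by simpa [he1])
    hS' hq hM hM' (fun hn => ih hn W hfin)
  have h1 : #{x : W × F | x.1 ∈ A} = #{v | v ∈ (A.prod ⊤).map e.toLinearMap} :=
    Finset.card_equiv e.toEquiv (by simp)
  have h2 : #{x : W × F | x.1 ∈ A ∧ (c ∘ e.toLinearMap) x ≠ 0}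
      = #{v | v ∈ (A.prod ⊤).map e.toLinearMap ∧ c v ≠ 0} :=
    Finset.card_equiv e.toEquiv (by simp)
  refine ⟨(A.prod ⊤).map e.toLinearMap, ?_, ?_⟩
  · have h3 : (Finset.univ.filter fun x : W × F => x.1 ∈ A)
        = (Finset.univ.filter fun v : W => v ∈ A) ×ˢ Finset.univ := by
      ext x
      simp
    rw [card_submodule, h3, Finset.card_product, card_submodule, Finset.card_univ, ← pow_succ]
      at h1
    have := Nat.pow_right_injective (by omega : 2 ≤ Fintype.card F) h1
    omega
  · rw [← h1, ← h2]
    exact hlt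

/-- A codeword of small weight is a sum of few hyperplanes. -/
theorem isHypSum_of_card_le.{u} {p : ℕ} [Fact p.Prime] {F : Type*} [Field F] [Fintype F]
    [CharP F p] {N : ℕ} (hq : 32 ≤ Fintype.card F) (hN : 4 * N ^ 2 ≤ Fintype.card F)
    (hNp : 2 * (N + 2) * p ≤ Fintype.card F) (n : ℕ) :
    ∀ (M : ℕ) (V : Type u) [AddCommGroup V] [Module F V] [Fintype V], M + n ≤ N →
      finrank F V = n + 3 → ∀ c ∈ hypCode p F V,
      Fintype.card F * #{v : V | c v ≠ 0} ≤ M * Fintype.card V → IsHypSum F c M := by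
  have step : ∀ (n M : ℕ) (V : Type u) [AddCommGroup V] [Module F V] [Fintype V], M + n ≤ N →
      finrank F V = n + 3 →
      (0 < n → ∀ W : Submodule F V, finrank F W = n + 2 → ∀ c' ∈ hypCode p F W,
        Fintype.card F * #{v : W | c' v ≠ 0} ≤ (M + 1) * Fintype.card W →
          IsHypSum F c' (M + 1)) →
      ∀ k : ℕ, ∀ c ∈ hypCode p F V, #{v : V | c v ≠ 0} = k →
      Fintype.card F * #{v : V | c v ≠ 0} ≤ M * Fintype.card V → IsHypSum F c M := by
    intro n M V _ _ _ hMn hV ih k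
    have hMN : 4 * M ^ 2 ≤ Fintype.card F :=
      (Nat.mul_le_mul_left 4 (Nat.pow_le_pow_left (by omega : M ≤ N) 2)).trans hN
    have hsmall : (M + 2) ^ 2 < Fintype.card F ∧ 4 * M + 6 < Fintype.card F ∧
        M * (M + 1) < Fintype.card F := by
      rcases le_or_gt M 2 with h | h
      · interval_cases M <;> omega
      · refine ⟨?_, ?_, ?_⟩ <;> nlinarith
    induction k using Nat.strong_induction_on with
    | _ k ihk =>
      intro c hc hk hS
      by_cases hzero : ∀ v, c v = 0
      · exact ⟨0, by simp, by simp, by simpa using hzero⟩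
      · push Not at hzero
        obtain ⟨v, hv⟩ := hzero
        obtain ⟨w, hw, hcw⟩ := exists_ne_zero_of_support hc (by omega) hv
        obtain ⟨H, hH, hlt⟩ := exists_rich_hyperplane hc hV hw hcw hS hq hMN
          (fun hn => (Nat.mul_le_mul_left 4
            (Nat.pow_le_pow_left (by omega : M + 1 ≤ N) 2)).trans hN) ih
        obtain ⟨α, -, hc', hlt'⟩ := exists_sub_hyperplane hc hS hsmall.1 hsmall.2.1
          ((Nat.mul_le_mul_right p (by omega : 2 * (M + 2) ≤ 2 * (N + 2))).trans hNp) hH hlt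
        exact (IsHypSum.of_sub hH (ihk _ (hk ▸ hlt') _ hc' rfl
          ((Nat.mul_le_mul_left _ hlt'.le).trans hS))).of_succ hS hsmall.2.2
  induction n with
  | zero =>
    intro M V _ _ _ hM hV c hc hS
    exact step 0 M V hM hV (fun h => absurd h (lt_irrefl 0)) _ c hc rfl hS
  | succ n ih =>
    intro M V _ _ _ hM hV c hc hS
    exact step (n + 1) M V hM hV
      (fun _ W hW c' hc' hS' => ih (M + 1) W (by omega) hW c' hc' hS') _ c hc rfl hS

end HyperplaneSum

/-! ### Codewords of projective spaces -/

section ProjectiveCode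

open scoped Finset

lemma two_mul_add_le_two_pow_mul {j : ℕ} (hj : 1 ≤ j) (m : ℕ) :
    2 * (m + j) ≤ 2 ^ j * (m + 1) := by
  have h1 : 2 * j ≤ 2 ^ j := by
    obtain ⟨i, rfl⟩ := Nat.exists_eq_add_of_le' hj
    have := Nat.lt_two_pow_self (n := i)
    rw [pow_succ]
    omega
  have h2 : 2 ^ 1 ≤ 2 ^ j := Nat.pow_le_pow_right (by norm_num) hj
  nlinarith

lemma four_mul_sq_le_of_pgDelta {p h n m : ℕ} (hp : p.Prime) (hh : 2 ≤ h) (hn : 3 ≤ n) (hm : 1 ≤ m)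
    (hq1 : 2 < h → max 32 (2 ^ (2 * n - 4)) ≤ p ^ h) (hq2 : h = 2 → 2 ^ (2 * n) ≤ p ^ h)
    (hΔ : pgDelta p h n = m + 1) :
    32 ≤ p ^ h ∧ 4 * (m + (n - 2)) ^ 2 ≤ p ^ h ∧ 2 * (m + (n - 2) + 2) * p ≤ p ^ h := by
  unfold pgDelta at hΔ
  split_ifs at hΔ with h2
  · have hq := (le_max_left _ _).trans (hq1 h2)
    have h3 := Int.floor_le (√((p : ℝ) ^ h) / (2 : ℝ) ^ ((n : ℤ) - 2))
    rw [hΔ, le_div_iff₀ (by positivity), show ((n : ℤ) - 2) = ((n - 2 : ℕ) : ℤ) by omega,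
      zpow_natCast] at h3
    have h4 : (2 ^ (n - 2) * (m + 1)) ^ 2 ≤ p ^ h := by
      rw [Real.le_sqrt (by positivity) (by positivity)] at h3
      rw [mul_comm]
      exact_mod_cast h3
    have h5 := two_mul_add_le_two_pow_mul (by omega : 1 ≤ n - 2) m
    have h6 : 4 * (m + (n - 2)) ^ 2 ≤ p ^ h := by
      refine le_trans ?_ h4
      calc 4 * (m + (n - 2)) ^ 2 = (2 * (m + (n - 2))) ^ 2 := by ring
        _ ≤ _ := Nat.pow_le_pow_left h5 2
    refine ⟨hq, h6, ?_⟩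
    have h7 : p ^ 3 ≤ p ^ h := Nat.pow_le_pow_right hp.pos h2
    obtain ⟨N, hN⟩ : ∃ N, N = m + (n - 2) := ⟨_, rfl⟩
    have hN2 : 2 ≤ N := by omega
    rw [← hN] at h6 ⊢
    generalize p ^ h = q at hq h6 h7
    rcases le_or_gt 64 q with h64 | h64
    · have h8 : (4 * N * p) ^ 6 ≤ q ^ 6 := by
        calc (4 * N * p) ^ 6 = 64 * ((4 * N ^ 2) ^ 3 * (p ^ 3) ^ 2) := by ring
          _ ≤ q * (q ^ 3 * q ^ 2) := by gcongr
          _ = q ^ 6 := by ring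
      have h9 := (Nat.pow_le_pow_iff_left (by norm_num)).mp h8
      nlinarith
    · have hp4 : p < 4 := by
        by_contra! hcon
        have := Nat.pow_le_pow_left hcon 3
        omega
      have hN4 : N < 4 := by nlinarith
      nlinarith
  · have h3 : h = 2 := by omega
    subst h3
    have hq := hq2 rfl
    have h3 := Int.floor_le ((p : ℝ) / (2 : ℝ) ^ (n : ℤ))
    rw [hΔ, le_div_iff₀ (by positivity), zpow_natCast] at h3
    have h4 : 2 ^ n * (m + 1) ≤ p := by
      rw [mul_comm]
      exact_mod_cast h3
    have h5 := (two_mul_add_le_two_pow_mul (by omega : 1 ≤ n) m).trans h4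
    have h6 : 2 ^ 6 ≤ 2 ^ (2 * n) := Nat.pow_le_pow_right (by norm_num) (by omega)
    refine ⟨by omega, ?_, ?_⟩
    · calc 4 * (m + (n - 2)) ^ 2 = (2 * (m + (n - 2))) ^ 2 := by ring
        _ ≤ p ^ 2 := Nat.pow_le_pow_left (by omega) 2
    · rw [sq]
      exact Nat.mul_le_mul_right p (by omega)

lemma pgTheta_mul_sub_one (q n : ℕ) :
    pgTheta q ((n : ℤ) - 1) * ((q : ℤ) - 1) = (q : ℤ) ^ n - 1 := by
  rw [pgTheta, show ((n : ℤ) - 1 + 1).toNat = n by simp, geom_sum_mul]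

lemma pgCeil_eq {q w k : ℕ} {m : ℤ} (hpos : 0 < pgTheta q m)
    (hlt : ((k : ℤ) - 1) * pgTheta q m < w) (hle : (w : ℤ) ≤ k * pgTheta q m) :
    pgCeil q w m = k := by
  have h1 : (0 : ℚ) < (pgTheta q m : ℤ) := by exact_mod_cast hpos
  have h2 : ⌈(w : ℚ) / ((pgTheta q m : ℤ) : ℚ)⌉ = (k : ℤ) := by
    rw [Int.ceil_eq_iff, lt_div_iff₀ h1, div_le_iff₀ h1]
    exact ⟨by exact_mod_cast hlt, by exact_mod_cast hle⟩
  rw [pgCeil, h2, Int.toNat_natCast]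

variable {p n : ℕ} {F : Type} [Field F]

lemma PGPoint.eq_span (P : PGPoint F n) {v : Fin (n + 1) → F} (hv : v ≠ 0) (hvP : v ∈ P.1) :
    P.1 = F ∙ v := by
  symm
  refine Submodule.eq_of_le_of_finrank_eq ?_ ?_
  · rwa [Submodule.span_singleton_le_iff_mem]
  · rw [finrank_span_singleton hv, P.2]

lemma PGPoint.le_iff_mem (P : PGPoint F n) {v : Fin (n + 1) → F} (hv : v ≠ 0) (hvP : v ∈ P.1)
    (H : Submodule F (Fin (n + 1) → F)) : P.1 ≤ H ↔ v ∈ H := by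
  rw [P.eq_span hv hvP, Submodule.span_singleton_le_iff_mem]

lemma PGPoint.exists_ne_zero (P : PGPoint F n) : ∃ v ≠ 0, v ∈ P.1 := by
  have h1 : P.1 ≠ ⊥ := by
    intro h
    have := P.2
    rw [h, finrank_bot] at this
    omega
  obtain ⟨v, hv, hv0⟩ := Submodule.exists_mem_ne_zero_of_ne_bot h1
  exact ⟨v, hv0, hv⟩

/-- `c'` takes at every nonzero vector the value of `c` at the point it spans. -/
def IsConeOver (c : PGPoint F n → ZMod p) (c' : (Fin (n + 1) → F) → ZMod p) : Prop :=
  ∀ (P : PGPoint F n) (v : Fin (n + 1) → F), v ≠ 0 → v ∈ P.1 → c' v = c P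

lemma exists_isConeOver {c : PGPoint F n → ZMod p} (hc : c ∈ pgCode p F n) :
    ∃ c' ∈ hypCode p F (Fin (n + 1) → F), IsConeOver c c' := by
  unfold pgCode at hc
  induction hc using Submodule.span_induction with
  | mem x hx =>
    obtain ⟨H, hH, rfl⟩ := hx
    refine ⟨_, indicator_mem_hypCode (H := H) (by simp [hH]) 1, fun P v hv hvP => ?_⟩
    simp only [pgInd, P.le_iff_mem hv hvP]
  | zero => exact ⟨0, Submodule.zero_mem _, fun P v _ _ => rfl⟩
  | add x y _ _ hx hy =>
    obtain ⟨x', hx', hx⟩ := hx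
    obtain ⟨y', hy', hy⟩ := hy
    exact ⟨x' + y', Submodule.add_mem _ hx' hy', fun P v hv hvP => by
      simp [hx P v hv hvP, hy P v hv hvP]⟩
  | smul a x _ hx =>
    obtain ⟨x', hx', hx⟩ := hx
    exact ⟨a • x', Submodule.smul_mem _ a hx', fun P v hv hvP => by simp [hx P v hv hvP]⟩

variable [Fintype F]

lemma card_nonzero_submodule {V : Type*} [AddCommGroup V] [Module F V] [Fintype V] [DecidableEq V]
    (H : Submodule F V) : #{v : V | v ∈ H ∧ v ≠ 0} = Fintype.card F ^ finrank F H - 1 := by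
  rw [← card_submodule, ← Finset.card_erase_of_mem (a := 0) (by simp)]
  congr 1
  ext v
  simp [and_comm]

lemma IsConeOver.card_support {c : PGPoint F n → ZMod p} {c' : (Fin (n + 1) → F) → ZMod p}
    (hc : IsConeOver c c') :
    #{v | v ≠ 0 ∧ c' v ≠ 0} = pgWt p F n c * (Fintype.card F - 1) := by
  have hfin : {P : PGPoint F n | c P ≠ 0}.Finite := Set.toFinite _
  have h1 : ({v | v ≠ 0 ∧ c' v ≠ 0} : Finset (Fin (n + 1) → F)) =
      hfin.toFinset.biUnion fun P => {v | v ∈ P.1 ∧ v ≠ 0} := by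
    ext v
    simp only [Finset.mem_filter, Finset.mem_univ, true_and, Finset.mem_biUnion,
      Set.Finite.mem_toFinset, Set.mem_ofPred_eq]
    constructor
    · rintro ⟨hv, hcv⟩
      have hvP := Submodule.mem_span_singleton_self (R := F) v
      refine ⟨⟨F ∙ v, finrank_span_singleton hv⟩, ?_, hvP, hv⟩
      rwa [← hc ⟨F ∙ v, finrank_span_singleton hv⟩ v hv hvP]
    · rintro ⟨P, hP, hvP, hv⟩
      exact ⟨hv, by rwa [hc P v hv hvP]⟩
  rw [h1, Finset.card_biUnion, pgWt, Set.ncard_eq_toFinset_card _ hfin]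
  · refine Finset.sum_const_nat fun P _ => ?_
    rw [card_nonzero_submodule, P.2, pow_one]
  · intro P _ Q _ hPQ
    refine Finset.disjoint_left.mpr fun v hvP hvQ => ?_
    simp only [Finset.mem_filter, Finset.mem_univ, true_and] at hvP hvQ
    exact hPQ (Subtype.ext ((P.eq_span hvP.2 hvP.1).trans (Q.eq_span hvQ.2 hvQ.1).symm))

lemma card_support_le_succ {V : Type*} [AddCommGroup V] [Fintype V] [DecidableEq V]
    (c : V → ZMod p) :
    #{v | c v ≠ 0} ≤ #{v | v ≠ 0 ∧ c v ≠ 0} + 1 := by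
  have h1 : ({v | c v ≠ 0} : Finset V) ⊆
      insert 0 ({v | v ≠ 0 ∧ c v ≠ 0} : Finset V) := by
    intro v hv
    simp only [Finset.mem_filter, Finset.mem_univ, true_and, Finset.mem_insert] at hv ⊢
    tauto
  exact (Finset.card_le_card h1).trans (Finset.card_insert_le _ _)

lemma card_support_hypSum_le {V : Type*} [AddCommGroup V] [Module F V] [Fintype V] [DecidableEq V]
    {d : ℕ} {c : V → ZMod p} {a : Submodule F V →₀ ZMod p}
    (haH : ∀ H ∈ a.support, finrank F H = d)
    (hac : ∀ v, c v = ∑ H ∈ a.support, if v ∈ H then a H else 0) :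
    #{v | v ≠ 0 ∧ c v ≠ 0} ≤ #a.support * (Fintype.card F ^ d - 1) := by
  have h1 : ({v | v ≠ 0 ∧ c v ≠ 0} : Finset V) ⊆
      a.support.biUnion fun H => {v | v ∈ H ∧ v ≠ 0} := by
    intro v hv
    simp only [Finset.mem_filter, Finset.mem_univ, true_and, Finset.mem_biUnion] at hv ⊢
    rw [hac] at hv
    obtain ⟨H, hH, hne⟩ := Finset.exists_ne_zero_of_sum_ne_zero hv.2
    exact ⟨H, hH, by_contra fun h => hne (by simp_all), hv.1⟩
  refine (Finset.card_le_card h1).trans (Finset.card_biUnion_le_card_mul _ _ _ fun H hH => ?_)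
  rw [card_nonzero_submodule, haH H hH]

lemma pgCeil_eq_of_bounds {q n k w S : ℕ} (hn : 1 ≤ n) (hq : 2 ≤ q) (hk : k * (k - 1) < q)
    (hle : w * (q - 1) ≤ k * (q ^ n - 1)) (hge : k * ((q + 1 - k) * q ^ (n + 1)) ≤ q ^ 2 * S)
    (hS : S ≤ w * (q - 1) + 1) : pgCeil q w ((n : ℤ) - 1) = k := by
  have hθ := pgTheta_mul_sub_one q n
  set θ := pgTheta q ((n : ℤ) - 1)
  have hqn : 2 ≤ q ^ n := hq.trans (Nat.le_self_pow (by omega) q)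
  have hq' : (0 : ℤ) < (q : ℤ) - 1 := by omega
  have hθpos : 0 < θ := by
    refine pos_of_mul_pos_left (b := (q : ℤ) - 1) ?_ hq'.le
    rw [hθ]
    have : (2 : ℤ) ≤ (q : ℤ) ^ n := by exact_mod_cast hqn
    omega
  refine pgCeil_eq hθpos ?_ ?_
  · by_contra! hcon
    obtain ⟨j, rfl⟩ : ∃ j, k = j + 1 :=
      Nat.exists_eq_succ_of_ne_zero (by rintro rfl; push_cast at hcon; linarith)
    obtain ⟨i, rfl⟩ : ∃ i, n = i + 1 := ⟨n - 1, by omega⟩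
    have h1 : (w : ℤ) * (q - 1) ≤ j * ((q : ℤ) ^ (i + 1) - 1) := by
      have := mul_le_mul_of_nonneg_right hcon hq'.le
      rw [mul_assoc, hθ] at this
      push_cast at this
      linarith
    have h2 : (j + 1) * ((q - j) * q ^ i) ≤ S := by
      refine Nat.le_of_mul_le_mul_left ?_ (by positivity : 0 < q ^ 2)
      calc q ^ 2 * ((j + 1) * ((q - j) * q ^ i))
          = (j + 1) * ((q + 1 - (j + 1)) * q ^ (i + 1 + 1)) := by
            rw [Nat.add_sub_add_right]
            ring
        _ ≤ _ := hge
    rw [Nat.add_sub_cancel] at hk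
    obtain ⟨r, hr⟩ : ∃ r, q = j + r := Nat.exists_eq_add_of_le (by nlinarith)
    have h3 : j * q + 1 ≤ (j + 1) * r := by
      rw [hr] at hk ⊢
      nlinarith
    rw [show q - j = r by omega, ← mul_assoc] at h2
    have h4 := ((Nat.mul_le_mul_right _ h3).trans h2).trans hS
    have h5 : 1 ≤ q ^ i := Nat.one_le_pow _ _ (by omega)
    rw [pow_succ] at h1
    zify [(by omega : 1 ≤ q)] at h4 h5 hS h2 hq
    rcases Nat.eq_zero_or_pos j with rfl | hj
    · obtain rfl : r = q := by omega
      push_cast at h1 h2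
      nlinarith
    · zify at hj
      nlinarith
  · refine le_of_mul_le_mul_right (a := (q : ℤ) - 1) ?_ hq'
    rw [mul_assoc, hθ]
    zify [(by omega : 1 ≤ q), (by omega : 1 ≤ q ^ n)] at hle
    exact hle

/-- Main theorem: any codeword of `C_{n-1}(n,q)` of weight at most `W(n,q)` is a
linear combination of exactly `⌈wt(c)/θ_{n-1}⌉` different hyperplanes. -/
theorem statement_7 (p h n : ℕ) (hp : p.Prime) (hh : 2 ≤ h) (hn : 3 ≤ n)
    (hq1 : 2 < h → max 32 (2 ^ (2 * n - 4)) ≤ p ^ h)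
    (hq2 : h = 2 → 2 ^ (2 * n) ≤ p ^ h)
    (F : Type) [Field F] [Fintype F] (hF : Fintype.card F = p ^ h)
    (c : PGPoint F n → ZMod p) (hc : c ∈ pgCode p F n)
    (hwt : (pgWt p F n c : ℤ) ≤ pgW p h n) :
    ∃ (H : Fin (pgCeil (p ^ h) (pgWt p F n c) ((n : ℤ) - 1)) → Submodule F (Fin (n + 1) → F))
      (α : Fin (pgCeil (p ^ h) (pgWt p F n c) ((n : ℤ) - 1)) → ZMod p),
      Function.Injective H ∧ (∀ i, finrank F (H i) = n) ∧ (∀ i, α i ≠ 0) ∧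
      c = fun P => ∑ i, α i * pgInd p F n (H i) P := by
  have := Fact.mk hp
  have hchar : CharP F p := by
    obtain ⟨r, _⟩ := CharP.exists F
    obtain ⟨k, hr, hk⟩ := FiniteField.card F r
    have h1 : r ∣ p ^ h := by
      rw [← hF, hk]
      exact dvd_pow_self r k.ne_zero
    rwa [← (Nat.prime_dvd_prime_iff_eq hr hp).mp (hr.dvd_of_dvd_pow h1)]
  suffices hk : ∃ k, pgCeil (p ^ h) (pgWt p F n c) ((n : ℤ) - 1) = k ∧
      ∃ (H : Fin k → Submodule F (Fin (n + 1) → F)) (α : Fin k → ZMod p),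
      Function.Injective H ∧ (∀ i, finrank F (H i) = n) ∧ (∀ i, α i ≠ 0) ∧
      c = fun P => ∑ i, α i * pgInd p F n (H i) P by
    obtain ⟨k, rfl, hk⟩ := hk
    exact hk
  have hq : 2 ≤ p ^ h := hp.two_le.trans (Nat.le_self_pow (by omega) p)
  have hθ := pgTheta_mul_sub_one (p ^ h) n
  have hθ0 : 0 ≤ pgTheta (p ^ h) ((n : ℤ) - 1) := Finset.sum_nonneg fun i _ => by positivity
  rcases le_or_gt (pgDelta p h n - 1) 0 with hΔ | hΔ
  · have hw : pgWt p F n c = 0 := by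
      have := mul_nonpos_of_nonpos_of_nonneg hΔ hθ0
      rw [pgW] at hwt
      omega
    refine ⟨0, by simp [hw, pgCeil], Fin.elim0, Fin.elim0, fun i => i.elim0, fun i => i.elim0,
      fun i => i.elim0, ?_⟩
    rw [pgWt, Set.ncard_eq_zero] at hw
    funext P
    simpa using Set.eq_empty_iff_forall_notMem.mp hw P
  obtain ⟨m, hm⟩ := Int.eq_ofNat_of_zero_le hΔ.le
  have hm1 : 1 ≤ m := by omega
  obtain ⟨h32, hN, hNp⟩ := four_mul_sq_le_of_pgDelta hp hh hn hm1 hq1 hq2 (by omega)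
  obtain ⟨c', hc', hcone⟩ := exists_isConeOver hc
  have hS := card_support_le_succ c'
  have hcard := hcone.card_support
  rw [hcard] at hS
  rw [pgW, hm] at hwt
  rw [← hF] at h32 hN hNp hq hθ hwt hθ0 ⊢
  have hV : Fintype.card (Fin (n + 1) → F) = Fintype.card F ^ (n + 1) := by simp
  have hsmall : Fintype.card F * #{v | c' v ≠ 0} ≤ m * Fintype.card (Fin (n + 1) → F) := by
    rw [hV, pow_succ, mul_comm (_ ^ n), mul_left_comm]
    refine Nat.mul_le_mul_left _ (hS.trans ?_)
    have h1 := mul_le_mul_of_nonneg_right hwt (by omega : (0 : ℤ) ≤ (Fintype.card F : ℤ) - 1)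
    rw [mul_assoc, hθ] at h1
    zify [(by omega : 1 ≤ Fintype.card F)]
    have h2 : (1 : ℤ) ≤ m := by exact_mod_cast hm1
    linarith
  obtain ⟨a, ha, haH, hac⟩ := isHypSum_of_card_le h32 hN hNp (n - 2) m (Fin (n + 1) → F) le_rfl
    (by simp; omega) c' hc' hsmall
  have haH' : ∀ H ∈ a.support, finrank F H = n := fun H hH => by simpa using haH H hH
  refine ⟨#a.support, pgCeil_eq_of_bounds (by omega) hq ?_
    (hcard ▸ card_support_hypSum_le haH' hac) (hV ▸ card_support_hypSum_ge haH hac) hS,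
    fun i => (a.support.equivFin.symm i).1, fun i => a (a.support.equivFin.symm i).1,
    Subtype.val_injective.comp (Equiv.injective _), fun i => haH' _ (Subtype.prop _),
    fun i => Finsupp.mem_support_iff.mp (Subtype.prop _), ?_⟩
  · have h1 : #a.support * (#a.support - 1) ≤ m * m := Nat.mul_le_mul ha (by omega)
    nlinarith
  · funext P
    obtain ⟨v, hv, hvP⟩ := P.exists_ne_zero
    rw [← hcone P v hv hvP, hac, ← Finset.sum_coe_sort, ← Equiv.sum_comp a.support.equivFin.symm]
    simp only [pgInd, P.le_iff_mem hv hvP, mul_ite, mul_one, mul_zero]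

end ProjectiveCode
end
end

section
/- Let p > 3 be a prime, h ≥ 2 an integer, q := p^h with q > 27. Let t be a line of PG(2,q), let R and S be two distinct points lying on t, let r₁, r₂, r' be three pairwise distinct lines through R each different from t, and let s₁, s₂, s' be three pairwise distinct lines through S each different from t. Then the codeword c := f_{r₁} + f_{r₂} − f_{r'} + f_{s₁} + f_{s₂} − f_{s'} − f_t of C_1(2,q) satisfies wt(c) = 7q − 14 and is a minimal codeword. -/
open Module

noncomputable section

open scoped Classical

section AffineCode

variable {F : Type} [Field F]

/-- The span of the indicator functions of the loci `A + B x + C y = 0` with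
`(A, B, C) ≠ 0` in the affine plane over `F`. -/
def affineCode (p : ℕ) (F : Type) [Field F] : Submodule (ZMod p) (F × F → ZMod p) :=
  Submodule.span (ZMod p)
    {f | ∃ A B C : F, (A ≠ 0 ∨ B ≠ 0 ∨ C ≠ 0) ∧
      f = fun z => if A + B * z.1 + C * z.2 = 0 then 1 else 0}

lemma affineCode_swap {p : ℕ} {g : F × F → ZMod p} (hg : g ∈ affineCode p F) :
    (fun z => g z.swap) ∈ affineCode p F := by
  induction hg using Submodule.span_induction with
  | mem f hf =>
    obtain ⟨A, B, C, h, rfl⟩ := hf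
    refine Submodule.subset_span ⟨A, C, B, by tauto, ?_⟩
    funext z
    simp only [Prod.fst_swap, Prod.snd_swap]
    simp only [add_right_comm]
  | zero => exact Submodule.zero_mem _
  | add f f' _ _ hf hf' => exact Submodule.add_mem _ hf hf'
  | smul a f _ hf => exact Submodule.smul_mem _ a hf

lemma affineCode_moment_quadratic [Fintype F] {p : ℕ} [Algebra (ZMod p) F] {k : ℕ} (hk : k ≤ 2)
    (hq : 3 < Fintype.card F) {g : F × F → ZMod p} (hg : g ∈ affineCode p F) :
    ∃ α β γ : F, ∀ u, ∑ y, algebraMap (ZMod p) F (g (u, y)) * y ^ k = α + β * u + γ * u ^ 2 := by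
  induction hg using Submodule.span_induction with
  | mem f hf =>
    obtain ⟨A, B, C, h, rfl⟩ := hf
    by_cases hC : C = 0
    · have hsum : ∑ y : F, y ^ k = 0 := FiniteField.sum_pow_lt_card_sub_one F k (by omega)
      refine ⟨0, 0, 0, fun u => ?_⟩
      subst hC
      by_cases hu : A + B * u = 0 <;> simp [hu, hsum]
    · have key : ∀ u : F, ∑ y, algebraMap (ZMod p) F
          (if A + B * u + C * y = 0 then 1 else 0) * y ^ k = (-(A + B * u) / C) ^ k := by
        intro u
        rw [Finset.sum_eq_single (-(A + B * u) / C)]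
        · rw [if_pos (by field_simp; ring)]; simp
        · intro y _ hy
          rw [if_neg]
          · simp
          · intro h0
            exact hy (by rw [eq_div_iff hC]; linear_combination h0)
        · simp
      simp only [key]
      interval_cases k
      · exact ⟨1, 0, 0, fun u => by ring⟩
      · exact ⟨-A / C, -B / C, 0, fun u => by ring⟩
      · exact ⟨A ^ 2 / C ^ 2, 2 * A * B / C ^ 2, B ^ 2 / C ^ 2, fun u => by ring⟩
  | zero => exact ⟨0, 0, 0, by simp⟩
  | add f f' _ _ hf hf' =>
    obtain ⟨α, β, γ, h⟩ := hf
    obtain ⟨α', β', γ', h'⟩ := hf'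
    refine ⟨α + α', β + β', γ + γ', fun u => ?_⟩
    simp only [Pi.add_apply, map_add, add_mul, Finset.sum_add_distrib, h, h']
    ring
  | smul a f _ hf =>
    obtain ⟨α, β, γ, h⟩ := hf
    refine ⟨algebraMap (ZMod p) F a * α, algebraMap (ZMod p) F a * β,
      algebraMap (ZMod p) F a * γ, fun u => ?_⟩
    simp only [Pi.smul_apply, smul_eq_mul, map_mul, mul_assoc, ← Finset.mul_sum, h]
    ring

lemma quadratic_eq_zero_of_three_roots {α β γ x y z : F} (hxy : x ≠ y) (hxz : x ≠ z)
    (hyz : y ≠ z) (hx : α + β * x + γ * x ^ 2 = 0) (hy : α + β * y + γ * y ^ 2 = 0)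
    (hz : α + β * z + γ * z ^ 2 = 0) : α = 0 ∧ β = 0 ∧ γ = 0 := by
  have h1 : β + γ * (x + y) = 0 :=
    mul_left_cancel₀ (sub_ne_zero.2 hxy) (by linear_combination hx - hy)
  have h2 : β + γ * (x + z) = 0 :=
    mul_left_cancel₀ (sub_ne_zero.2 hxz) (by linear_combination hx - hz)
  have h3 : γ = 0 := mul_left_cancel₀ (sub_ne_zero.2 hyz) (by linear_combination h1 - h2)
  subst h3
  have h4 : β = 0 := by simpa using h1
  subst h4
  exact ⟨by simpa using hx, rfl, rfl⟩

/-- A quadratic function with values in the prime field outside a set of three points is constant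
there, since it takes some value more than twice. -/
lemma exists_const_of_quadratic [Fintype F] {p : ℕ} [Fact p.Prime] [Algebra (ZMod p) F]
    (s : Finset F) (hs : s.card ≤ 3) (hq : 2 * p + 3 < Fintype.card F) (f : F → ZMod p)
    {α β γ : F} (hf : ∀ u ∉ s, algebraMap (ZMod p) F (f u) = α + β * u + γ * u ^ 2) :
    ∃ c, ∀ u ∉ s, f u = c := by
  obtain ⟨c, -, hc⟩ := Finset.exists_lt_card_fiber_of_mul_lt_card_of_maps_to
    (s := sᶜ) (t := (Finset.univ : Finset (ZMod p))) (f := f) (n := 2) (by simp)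
    (by rw [Finset.card_univ, ZMod.card, Finset.card_compl]; omega)
  obtain ⟨x, hx, y, hy, z, hz, hxy, hxz, hyz⟩ := Finset.two_lt_card.1 hc
  simp only [Finset.mem_filter, Finset.mem_compl] at hx hy hz
  have root : ∀ u, u ∉ s ∧ f u = c →
      (α - algebraMap (ZMod p) F c) + β * u + γ * u ^ 2 = 0 := by
    rintro u ⟨hu, rfl⟩
    rw [hf u hu]; ring
  obtain ⟨h1, h2, h3⟩ :=
    quadratic_eq_zero_of_three_roots hxy hxz hyz (root x hx) (root y hy) (root z hz)
  refine ⟨c, fun u hu => (algebraMap (ZMod p) F).injective ?_⟩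
  rw [hf u hu, h2, h3]
  linear_combination h1

lemma sum_eq_three [Fintype F] {b₁ b₂ b₃ : F} (h12 : b₁ ≠ b₂) (h13 : b₁ ≠ b₃) (h23 : b₂ ≠ b₃)
    (f : F → F) (hf : ∀ y, y ≠ b₁ → y ≠ b₂ → y ≠ b₃ → f y = 0) :
    ∑ y, f y = f b₁ + f b₂ + f b₃ := by
  rw [← Finset.sum_subset (Finset.subset_univ {b₁, b₂, b₃})]
  · rw [Finset.sum_insert (by simp [h12, h13]), Finset.sum_pair h23, add_assoc]
  · intro y _ hy
    simp only [Finset.mem_insert, Finset.mem_singleton, not_or] at hy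
    exact hf y hy.1 hy.2.1 hy.2.2

/-- If almost all columns of a codeword are supported on three rows, then its restriction to any
of these rows is quadratic. -/
lemma affineCode_row_quadratic [Fintype F] {p : ℕ} [Algebra (ZMod p) F]
    (hq : 3 < Fintype.card F) {g : F × F → ZMod p} (hg : g ∈ affineCode p F) (s : Set F)
    {b₁ b₂ b₃ : F} (h12 : b₁ ≠ b₂) (h13 : b₁ ≠ b₃) (h23 : b₂ ≠ b₃)
    (hsupp : ∀ u ∉ s, ∀ y, y ≠ b₁ → y ≠ b₂ → y ≠ b₃ → g (u, y) = 0) :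
    ∃ α β γ : F, ∀ u ∉ s, algebraMap (ZMod p) F (g (u, b₁)) = α + β * u + γ * u ^ 2 := by
  obtain ⟨α₀, β₀, γ₀, h₀⟩ := affineCode_moment_quadratic (k := 0) (by omega) hq hg
  obtain ⟨α₁, β₁, γ₁, h₁⟩ := affineCode_moment_quadratic (k := 1) (by omega) hq hg
  obtain ⟨α₂, β₂, γ₂, h₂⟩ := affineCode_moment_quadratic (k := 2) (by omega) hq hg
  have hd : (b₁ - b₂) * (b₁ - b₃) ≠ 0 := mul_ne_zero (sub_ne_zero.2 h12) (sub_ne_zero.2 h13)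
  refine ⟨(α₂ - (b₂ + b₃) * α₁ + b₂ * b₃ * α₀) / ((b₁ - b₂) * (b₁ - b₃)),
    (β₂ - (b₂ + b₃) * β₁ + b₂ * b₃ * β₀) / ((b₁ - b₂) * (b₁ - b₃)),
    (γ₂ - (b₂ + b₃) * γ₁ + b₂ * b₃ * γ₀) / ((b₁ - b₂) * (b₁ - b₃)), fun u hu => ?_⟩
  have e : ∀ k : ℕ, ∑ y, algebraMap (ZMod p) F (g (u, y)) * y ^ k =
      algebraMap (ZMod p) F (g (u, b₁)) * b₁ ^ k + algebraMap (ZMod p) F (g (u, b₂)) * b₂ ^ k +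
        algebraMap (ZMod p) F (g (u, b₃)) * b₃ ^ k := fun k =>
    sum_eq_three h12 h13 h23 _ fun y h h' h'' => by simp [hsupp u hu y h h' h'']
  have e₀ := (e 0).symm.trans (h₀ u)
  have e₁ := (e 1).symm.trans (h₁ u)
  have e₂ := (e 2).symm.trans (h₂ u)
  rw [div_mul_eq_mul_div, div_mul_eq_mul_div, ← add_div, ← add_div, eq_div_iff hd]
  linear_combination e₂ - (b₂ + b₃) * e₁ + b₂ * b₃ * e₀

lemma affineCode_row_const [Fintype F] {p : ℕ} [Fact p.Prime] [Algebra (ZMod p) F]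
    (hq : 2 * p + 3 < Fintype.card F) {g : F × F → ZMod p} (hg : g ∈ affineCode p F)
    {a₁ a₂ a₃ b₁ b₂ b₃ : F} (h12 : b₁ ≠ b₂) (h13 : b₁ ≠ b₃) (h23 : b₂ ≠ b₃)
    (hsupp : ∀ x y, x ≠ a₁ → x ≠ a₂ → x ≠ a₃ → y ≠ b₁ → y ≠ b₂ → y ≠ b₃ → g (x, y) = 0) :
    ∃ c, ∀ x, x ≠ a₁ → x ≠ a₂ → x ≠ a₃ → g (x, b₁) = c := by
  obtain ⟨α, β, γ, h⟩ := affineCode_row_quadratic (by omega) hg ({a₁, a₂, a₃} : Finset F)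
    h12 h13 h23 (fun u hu y => by
      simp only [Finset.coe_insert, Finset.coe_singleton, Set.mem_insert_iff,
        Set.mem_singleton_iff, not_or] at hu
      exact hsupp u y hu.1 hu.2.1 hu.2.2)
  obtain ⟨c, hc⟩ := exists_const_of_quadratic {a₁, a₂, a₃} Finset.card_le_three hq
    (fun u => g (u, b₁)) h
  exact ⟨c, fun x h1 h2 h3 => hc x (by simp [h1, h2, h3])⟩

lemma affineCode_vertical {p : ℕ} (a : F) :
    (fun z : F × F => if z.1 = a then 1 else 0) ∈ affineCode p F := by
  refine Submodule.subset_span ⟨-a, 1, 0, by simp, funext fun z => ?_⟩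
  simp [neg_add_eq_zero, eq_comm]

lemma affineCode_horizontal {p : ℕ} (b : F) :
    (fun z : F × F => if z.2 = b then 1 else 0) ∈ affineCode p F := by
  refine Submodule.subset_span ⟨-b, 0, 1, by simp, funext fun z => ?_⟩
  simp [neg_add_eq_zero, eq_comm]

lemma affineCode_eq_zero_of_grid [Fintype F] {p : ℕ} [Fact p.Prime] [Algebra (ZMod p) F]
    (hq : 2 * p + 3 < Fintype.card F) {g : F × F → ZMod p} (hg : g ∈ affineCode p F)
    {a₁ a₂ a₃ b₁ b₂ b₃ : F} (h12 : b₁ ≠ b₂) (h13 : b₁ ≠ b₃) (h23 : b₂ ≠ b₃)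
    (hrow : ∀ x y, y ≠ b₁ → y ≠ b₂ → y ≠ b₃ → g (x, y) = 0)
    (hcol : ∀ x, x ≠ a₁ → x ≠ a₂ → x ≠ a₃ → g (x, b₁) = 0) (x : F) : g (x, b₁) = 0 := by
  obtain ⟨α, β, γ, h⟩ := affineCode_row_quadratic (by omega) hg ∅ h12 h13 h23 fun u _ => hrow u
  have hp := (Fact.out : p.Prime).two_le
  have hcard : 2 < (({a₁, a₂, a₃} : Finset F)ᶜ).card := by
    have := Finset.card_le_three (a := a₁) (b := a₂) (c := a₃)
    rw [Finset.card_compl]; omega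
  obtain ⟨u, hu, v, hv, w, hw, huv, huw, hvw⟩ := Finset.two_lt_card.1 hcard
  simp only [Finset.mem_compl, Finset.mem_insert, Finset.mem_singleton, not_or] at hu hv hw
  have root : ∀ u, u ≠ a₁ ∧ u ≠ a₂ ∧ u ≠ a₃ → α + β * u + γ * u ^ 2 = 0 := fun u hu => by
    rw [← h u (by simp), hcol u hu.1 hu.2.1 hu.2.2, map_zero]
  obtain ⟨rfl, rfl, rfl⟩ :=
    quadratic_eq_zero_of_three_roots huv huw hvw (root u hu) (root v hv) (root w hw)
  apply (algebraMap (ZMod p) F).injective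
  rw [h x (by simp)]
  simp

/-- A codeword supported on three vertical and three horizontal lines is a combination of these
lines. -/
lemma affineCode_supported_on_grid [Fintype F] {p : ℕ} [Fact p.Prime] [Algebra (ZMod p) F]
    (hq : 2 * p + 3 < Fintype.card F) {g : F × F → ZMod p} (hg : g ∈ affineCode p F)
    {a₁ a₂ a₃ b₁ b₂ b₃ : F} (ha12 : a₁ ≠ a₂) (ha13 : a₁ ≠ a₃) (ha23 : a₂ ≠ a₃)
    (hb12 : b₁ ≠ b₂) (hb13 : b₁ ≠ b₃) (hb23 : b₂ ≠ b₃)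
    (hsupp : ∀ x y, x ≠ a₁ → x ≠ a₂ → x ≠ a₃ → y ≠ b₁ → y ≠ b₂ → y ≠ b₃ → g (x, y) = 0) :
    ∃ η₁ η₂ η₃ γ₁ γ₂ γ₃ : ZMod p, ∀ x y, g (x, y) =
      η₁ * (if x = a₁ then 1 else 0) + η₂ * (if x = a₂ then 1 else 0)
      + η₃ * (if x = a₃ then 1 else 0) + γ₁ * (if y = b₁ then 1 else 0)
      + γ₂ * (if y = b₂ then 1 else 0) + γ₃ * (if y = b₃ then 1 else 0) := by
  obtain ⟨γ₁, hγ₁⟩ := affineCode_row_const hq hg hb12 hb13 hb23 hsupp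
  obtain ⟨γ₂, hγ₂⟩ := affineCode_row_const hq hg hb12.symm hb23 hb13
    (fun x y h h' h'' k k' k'' => hsupp x y h h' h'' k' k k'')
  obtain ⟨γ₃, hγ₃⟩ := affineCode_row_const hq hg hb13.symm hb23.symm hb12
    (fun x y h h' h'' k k' k'' => hsupp x y h h' h'' k' k'' k)
  have hg' := affineCode_swap hg
  obtain ⟨η₁, hη₁⟩ := affineCode_row_const hq hg' ha12 ha13 ha23
    (fun y x k k' k'' h h' h'' => hsupp x y h h' h'' k k' k'')
  obtain ⟨η₂, hη₂⟩ := affineCode_row_const hq hg' ha12.symm ha23 ha13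
    (fun y x k k' k'' h h' h'' => hsupp x y h' h h'' k k' k'')
  obtain ⟨η₃, hη₃⟩ := affineCode_row_const hq hg' ha13.symm ha23.symm ha12
    (fun y x k k' k'' h h' h'' => hsupp x y h' h'' h k k' k'')
  simp only [Prod.swap_prod_mk] at hη₁ hη₂ hη₃
  refine ⟨η₁, η₂, η₃, γ₁, γ₂, γ₃, ?_⟩
  set d : F × F → ZMod p := g - (η₁ • (fun z : F × F => if z.1 = a₁ then 1 else 0)
    + η₂ • (fun z : F × F => if z.1 = a₂ then 1 else 0)
    + η₃ • (fun z : F × F => if z.1 = a₃ then 1 else 0)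
    + γ₁ • (fun z : F × F => if z.2 = b₁ then 1 else 0)
    + γ₂ • (fun z : F × F => if z.2 = b₂ then 1 else 0)
    + γ₃ • (fun z : F × F => if z.2 = b₃ then 1 else 0)) with hd
  have hdmem : d ∈ affineCode p F := by
    refine Submodule.sub_mem _ hg ?_
    refine Submodule.add_mem _ (Submodule.add_mem _ (Submodule.add_mem _ (Submodule.add_mem _
      (Submodule.add_mem _ ?_ ?_) ?_) ?_) ?_) ?_ <;> apply Submodule.smul_mem
    exacts [affineCode_vertical _, affineCode_vertical _, affineCode_vertical _,
      affineCode_horizontal _, affineCode_horizontal _, affineCode_horizontal _]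
  have hdapp : ∀ x y, d (x, y) = g (x, y) - (η₁ * (if x = a₁ then 1 else 0)
      + η₂ * (if x = a₂ then 1 else 0)
      + η₃ * (if x = a₃ then 1 else 0) + γ₁ * (if y = b₁ then 1 else 0)
      + γ₂ * (if y = b₂ then 1 else 0) + γ₃ * (if y = b₃ then 1 else 0)) := fun x y => rfl
  have hrow : ∀ x y, y ≠ b₁ → y ≠ b₂ → y ≠ b₃ → d (x, y) = 0 := by
    intro x y k k' k''
    rw [hdapp]
    by_cases h1 : x = a₁
    · subst h1; simp [*]
    by_cases h2 : x = a₂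
    · subst h2; simp [*]
    by_cases h3 : x = a₃
    · subst h3; simp [*]
    simp [*]
  have hz : ∀ x y, d (x, y) = 0 := by
    intro x y
    by_cases k1 : y = b₁
    · subst k1
      exact affineCode_eq_zero_of_grid hq hdmem hb12 hb13 hb23 hrow
        (a₁ := a₁) (a₂ := a₂) (a₃ := a₃) (fun x h h' h'' => by rw [hdapp]; simp [*]) x
    by_cases k2 : y = b₂
    · subst k2
      exact affineCode_eq_zero_of_grid hq hdmem hb12.symm hb23 hb13
        (fun x y k k' k'' => hrow x y k' k k'')
        (a₁ := a₁) (a₂ := a₂) (a₃ := a₃) (fun x h h' h'' => by rw [hdapp]; simp [*]) x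
    by_cases k3 : y = b₃
    · subst k3
      exact affineCode_eq_zero_of_grid hq hdmem hb13.symm hb23.symm hb12
        (fun x y k k' k'' => hrow x y k' k'' k)
        (a₁ := a₁) (a₂ := a₂) (a₃ := a₃) (fun x h h' h'' => by rw [hdapp]; simp [*]) x
    exact hrow x y k1 k2 k3
  intro x y
  exact sub_eq_zero.1 ((hdapp x y).symm.trans (hz x y))

end AffineCode

section Coordinates

variable {F : Type} [Field F] (e : Basis (Fin 3) F (Fin 3 → F))

/-- The point of `PG(2,q)` with the given nonzero homogeneous coordinates. -/
def pgOfCoords (w : Fin 3 → F) (hw : w ≠ 0) : PGPoint F 2 :=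
  ⟨F ∙ e.equivFun.symm w, finrank_span_singleton (by rwa [Ne, LinearEquiv.map_eq_zero_iff])⟩

/-- The points of `PG(2,q)`: the affine points `(1 : x : y)`, the points `(0 : 1 : m)`, and the
point `(0 : 0 : 1)`. -/
def pgCoordPoint : (F × F) ⊕ Option F → PGPoint F 2
  | .inl z => pgOfCoords e ![1, z.1, z.2] fun h => one_ne_zero (congrFun h 0)
  | .inr (some m) => pgOfCoords e ![0, 1, m] fun h => one_ne_zero (congrFun h 1)
  | .inr none => pgOfCoords e ![0, 0, 1] fun h => one_ne_zero (congrFun h 2)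

lemma pgOfCoords_eq_iff {w w' : Fin 3 → F} (hw : w ≠ 0) (hw' : w' ≠ 0) :
    pgOfCoords e w hw = pgOfCoords e w' hw' ↔ ∃ a : F, a ≠ 0 ∧ a • w = w' := by
  rw [pgOfCoords, pgOfCoords, Subtype.mk.injEq, Submodule.span_singleton_eq_span_singleton]
  constructor
  · rintro ⟨a, ha⟩
    refine ⟨a, a.ne_zero, e.equivFun.symm.injective ?_⟩
    rw [map_smul]
    exact ha
  · rintro ⟨a, ha, rfl⟩
    exact ⟨Units.mk0 a ha, by rw [map_smul]; rfl⟩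

lemma exists_pgOfCoords (P : PGPoint F 2) : ∃ w hw, pgOfCoords e w hw = P := by
  obtain ⟨v, hv, hP⟩ := finrank_eq_one_iff'.1 P.2
  refine ⟨e.equivFun v, by simpa using hv, Subtype.ext ?_⟩
  rw [pgOfCoords]
  simp only [LinearEquiv.symm_apply_apply]
  refine le_antisymm (by simp) fun x hx => ?_
  obtain ⟨c, hc⟩ := hP ⟨x, hx⟩
  exact Submodule.mem_span_singleton.2 ⟨c, congrArg Subtype.val hc⟩

lemma pgCoordPoint_bijective : Function.Bijective (pgCoordPoint e) := by
  constructor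
  · rintro (⟨x, y⟩ | _ | m) (⟨x', y'⟩ | _ | m') h
    case inr.none.inr.none => rfl
    all_goals
      simp only [pgCoordPoint, pgOfCoords_eq_iff] at h
      obtain ⟨a, ha, h⟩ := h
      have h0 := congrFun h 0
      have h1 := congrFun h 1
      have h2 := congrFun h 2
      simp_all
  · intro P
    obtain ⟨w, hw, rfl⟩ := exists_pgOfCoords e P
    by_cases h0 : w 0 = 0
    · by_cases h1 : w 1 = 0
      · have h2 : w 2 ≠ 0 := fun h2 => hw (by ext i; fin_cases i <;> assumption)
        refine ⟨.inr none, ?_⟩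
        rw [pgCoordPoint, pgOfCoords_eq_iff]
        refine ⟨w 2, h2, ?_⟩
        ext i; fin_cases i <;> simp [*]
      · refine ⟨.inr (some (w 2 / w 1)), ?_⟩
        rw [pgCoordPoint, pgOfCoords_eq_iff]
        refine ⟨w 1, h1, ?_⟩
        ext i; fin_cases i <;> simp [*]; field_simp
    · refine ⟨.inl (w 1 / w 0, w 2 / w 0), ?_⟩
      rw [pgCoordPoint, pgOfCoords_eq_iff]
      refine ⟨w 0, h0, ?_⟩
      ext i; fin_cases i <;> simp <;> field_simp

/-- The linear form with the given coefficients with respect to the dual basis. -/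
def coordForm (A : Fin 3 → F) : (Fin 3 → F) →ₗ[F] F := ∑ i, A i • e.coord i

lemma pgOfCoords_le_ker_iff (A w : Fin 3 → F) (hw : w ≠ 0) :
    (pgOfCoords e w hw).1 ≤ LinearMap.ker (coordForm e A) ↔
      A 0 * w 0 + A 1 * w 1 + A 2 * w 2 = 0 := by
  simp [pgOfCoords, coordForm, Fin.sum_univ_three]

lemma exists_eq_ker_coordForm {H : Submodule F (Fin 3 → F)} (hH : finrank F H = 2) :
    ∃ A : Fin 3 → F, A ≠ 0 ∧ H = LinearMap.ker (coordForm e A) := by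
  have hlt : H < ⊤ := lt_of_le_of_ne le_top fun h => by
    rw [h, finrank_top, Module.finrank_fin_fun] at hH
    omega
  obtain ⟨φ, hφ, hle⟩ := Submodule.exists_le_ker_of_lt_top H hlt
  have hform : coordForm e (fun i => φ (e i)) = φ := by
    refine e.ext fun i => ?_
    fin_cases i <;> simp [coordForm]
  refine ⟨fun i => φ (e i), fun h => hφ (e.ext fun i => congrFun h i), ?_⟩
  rw [hform]
  refine Submodule.eq_of_le_of_finrank_le hle ?_
  have := Submodule.finrank_lt fun h => hφ (LinearMap.ker_eq_top.1 h)
  rw [Module.finrank_fin_fun] at this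
  omega

lemma pgInd_ker_coordForm (p : ℕ) (A : Fin 3 → F) :
    (∀ z : F × F, pgInd p F 2 (LinearMap.ker (coordForm e A)) (pgCoordPoint e (.inl z)) =
      if A 0 + A 1 * z.1 + A 2 * z.2 = 0 then 1 else 0) ∧
    (∀ m, pgInd p F 2 (LinearMap.ker (coordForm e A)) (pgCoordPoint e (.inr (some m))) =
      if A 1 + A 2 * m = 0 then 1 else 0) ∧
    pgInd p F 2 (LinearMap.ker (coordForm e A)) (pgCoordPoint e (.inr none)) =
      if A 2 = 0 then 1 else 0 := by
  refine ⟨fun z => ?_, fun m => ?_, ?_⟩ <;>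
    simp [pgInd, pgCoordPoint, pgOfCoords_le_ker_iff]

lemma affine_part_mem_affineCode {p : ℕ} {c : PGPoint F 2 → ZMod p} (hc : c ∈ pgCode p F 2) :
    (fun z => c (pgCoordPoint e (.inl z))) ∈ affineCode p F := by
  induction hc using Submodule.span_induction with
  | mem f hf =>
    obtain ⟨H, hH, rfl⟩ := hf
    obtain ⟨A, hA, rfl⟩ := exists_eq_ker_coordForm e hH
    refine Submodule.subset_span ⟨A 0, A 1, A 2, ?_, funext (pgInd_ker_coordForm e p A).1⟩
    by_contra! h
    exact hA (by ext i; fin_cases i; exacts [h.1, h.2.1, h.2.2])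
  | zero => exact Submodule.zero_mem _
  | add f f' _ _ hf hf' => exact Submodule.add_mem _ hf hf'
  | smul a f _ hf => exact Submodule.smul_mem _ a hf

lemma sum_affine_line_incidence [Fintype F] {p : ℕ} (hF : (Fintype.card F : ZMod p) = 0)
    (A B : F) :
    (∑ x : F, if A + B * x = 0 then (1 : ZMod p) else 0) + (if B = 0 then 1 else 0) = 1 := by
  by_cases hB : B = 0
  · subst hB
    by_cases hA : A = 0 <;> simp [hA, hF]
  · rw [Finset.sum_eq_single (-A / B)]
    · rw [if_pos (by field_simp; ring), if_neg hB, add_zero]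
    · intro x _ hx
      exact if_neg fun h => hx (by rw [eq_div_iff hB]; linear_combination h)
    · simp

/-- The sums of a codeword over the lines through `(1 : 0 : 0)` agree. -/
lemma pgCode_line_sum [Fintype F] {p : ℕ} (hF : (Fintype.card F : ZMod p) = 0)
    {c : PGPoint F 2 → ZMod p} (hc : c ∈ pgCode p F 2) (m : F) :
    (∑ x, c (pgCoordPoint e (.inl (x, m * x)))) + c (pgCoordPoint e (.inr (some m))) =
      (∑ y, c (pgCoordPoint e (.inl (0, y)))) + c (pgCoordPoint e (.inr none)) := by
  induction hc using Submodule.span_induction with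
  | mem f hf =>
    obtain ⟨H, hH, rfl⟩ := hf
    obtain ⟨A, hA, rfl⟩ := exists_eq_ker_coordForm e hH
    obtain ⟨h1, h2, h3⟩ := pgInd_ker_coordForm e p A
    have e1 := sum_affine_line_incidence hF (A 0) (A 1 + A 2 * m)
    have e2 := sum_affine_line_incidence hF (A 0) (A 2)
    simp only [h1, h2, h3, mul_zero, add_zero]
    rw [e2, ← e1]
    congr 2 with x
    congr 2
    ring
  | zero => simp
  | add f f' _ _ hf hf' =>
    simp only [Pi.add_apply, Finset.sum_add_distrib]
    linear_combination hf + hf'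
  | smul a f _ hf =>
    simp only [Pi.smul_apply, smul_eq_mul, ← Finset.mul_sum]
    linear_combination a * hf

lemma pgCode_eq_of_affine_part_eq_zero [Fintype F] {p : ℕ} (hF : (Fintype.card F : ZMod p) = 0)
    {c : PGPoint F 2 → ZMod p} (hc : c ∈ pgCode p F 2)
    (h : ∀ z, c (pgCoordPoint e (.inl z)) = 0) (m : F) :
    c (pgCoordPoint e (.inr (some m))) = c (pgCoordPoint e (.inr none)) := by
  simpa [h] using pgCode_line_sum e hF hc m

lemma coordForm_smul (a : F) (A : Fin 3 → F) : coordForm e (a • A) = a • coordForm e A := by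
  simp [coordForm, Finset.smul_sum, mul_smul]

lemma ker_coordForm_smul {a : F} (ha : a ≠ 0) (A : Fin 3 → F) :
    LinearMap.ker (coordForm e (a • A)) = LinearMap.ker (coordForm e A) := by
  rw [coordForm_smul, LinearMap.ker_smul _ _ ha]

lemma eq_ker_of_mem_infinity {t : Submodule F (Fin 3 → F)} (ht : finrank F t = 2)
    (h1 : e 1 ∈ t) (h2 : e 2 ∈ t) : t = LinearMap.ker (coordForm e ![1, 0, 0]) := by
  obtain ⟨A, hA, rfl⟩ := exists_eq_ker_coordForm e ht
  have hA1 : A 1 = 0 := by simpa [coordForm, Fin.sum_univ_three] using h1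
  have hA2 : A 2 = 0 := by simpa [coordForm, Fin.sum_univ_three] using h2
  have hA0 : A 0 ≠ 0 := fun h => hA (by ext i; fin_cases i <;> assumption)
  rw [← ker_coordForm_smul e hA0 ![1, 0, 0]]
  congr 2
  ext i; fin_cases i <;> simp [*]

lemma exists_vertical {t r : Submodule F (Fin 3 → F)} (hr : finrank F r = 2)
    (ht : t = LinearMap.ker (coordForm e ![1, 0, 0])) (h : e 2 ∈ r) (hrt : r ≠ t) :
    ∃ a, r = LinearMap.ker (coordForm e ![-a, 1, 0]) := by
  obtain ⟨A, hA, rfl⟩ := exists_eq_ker_coordForm e hr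
  have hA2 : A 2 = 0 := by simpa [coordForm, Fin.sum_univ_three] using h
  have hA1 : A 1 ≠ 0 := fun hA1 => by
    have hA0 : A 0 ≠ 0 := fun h => hA (by ext i; fin_cases i <;> assumption)
    apply hrt
    rw [ht, ← ker_coordForm_smul e hA0 ![1, 0, 0]]
    congr 2
    ext i; fin_cases i <;> simp [*]
  refine ⟨-(A 0 / A 1), ?_⟩
  rw [← ker_coordForm_smul e hA1 ![_, _, _]]
  congr 2
  ext i; fin_cases i <;> simp [*]; field_simp

lemma exists_horizontal {t s : Submodule F (Fin 3 → F)} (hs : finrank F s = 2)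
    (ht : t = LinearMap.ker (coordForm e ![1, 0, 0])) (h : e 1 ∈ s) (hst : s ≠ t) :
    ∃ b, s = LinearMap.ker (coordForm e ![-b, 0, 1]) := by
  obtain ⟨A, hA, rfl⟩ := exists_eq_ker_coordForm e hs
  have hA1 : A 1 = 0 := by simpa [coordForm, Fin.sum_univ_three] using h
  have hA2 : A 2 ≠ 0 := fun hA2 => by
    have hA0 : A 0 ≠ 0 := fun h => hA (by ext i; fin_cases i <;> assumption)
    apply hst
    rw [ht, ← ker_coordForm_smul e hA0 ![1, 0, 0]]
    congr 2
    ext i; fin_cases i <;> simp [*]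
  refine ⟨-(A 0 / A 2), ?_⟩
  rw [← ker_coordForm_smul e hA2 ![_, _, _]]
  congr 2
  ext i; fin_cases i <;> simp [*]; field_simp

end Coordinates

/-- Two distinct points on a line span it, and extend to a coordinate frame. -/
lemma exists_basis_of_points {F : Type} [Field F] {t : Submodule F (Fin 3 → F)}
    (ht : finrank F t = 2) {R S : PGPoint F 2} (hRS : R ≠ S) (hR : R.1 ≤ t) (hS : S.1 ≤ t) :
    ∃ e : Basis (Fin 3) F (Fin 3 → F), e 1 ∈ S.1 ∧ e 2 ∈ R.1 := by
  obtain ⟨w, hw, rfl⟩ := exists_pgOfCoords (Pi.basisFun F (Fin 3)) R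
  obtain ⟨v, hv, rfl⟩ := exists_pgOfCoords (Pi.basisFun F (Fin 3)) S
  have hwt : w ∈ t := by simpa [pgOfCoords] using hR
  have hvt : v ∈ t := by simpa [pgOfCoords] using hS
  obtain ⟨u, hu⟩ : ∃ u, u ∉ t := by
    by_contra! h
    rw [(Submodule.eq_top_iff').2 h, finrank_top, Module.finrank_fin_fun] at ht
    omega
  have hvw : LinearIndependent F ![v, w] := by
    refine (LinearIndependent.pair_iff' hv).2 fun a ha => hRS ?_
    refine (pgOfCoords_eq_iff _ _ _).2 ⟨a⁻¹, ?_⟩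
    have ha0 : a ≠ 0 := by rintro rfl; exact hw (by simpa using ha.symm)
    exact ⟨inv_ne_zero ha0, by rw [← ha, inv_smul_smul₀ ha0]⟩
  have hli : LinearIndependent F ![u, v, w] := by
    refine hvw.finCons' _ _ ?_
    intro c y hy h
    by_contra hc
    have hyt : y ∈ t := Submodule.span_le.2 (by
      rintro _ ⟨i, rfl⟩; fin_cases i <;> assumption) hy
    refine hu ((t.smul_mem_iff hc).1 ?_)
    rw [eq_neg_of_add_eq_zero_left h]
    exact t.neg_mem hyt
  refine ⟨basisOfLinearIndependentOfCardEqFinrank hli (by simp), ?_, ?_⟩ <;> simp [pgOfCoords]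

section Weight

variable {F : Type} [Field F]

lemma pgInd_infinity (e : Basis (Fin 3) F (Fin 3 → F)) (p : ℕ) :
    (∀ z, pgInd p F 2 (LinearMap.ker (coordForm e ![1, 0, 0])) (pgCoordPoint e (.inl z)) = 0) ∧
    (∀ i, pgInd p F 2 (LinearMap.ker (coordForm e ![1, 0, 0])) (pgCoordPoint e (.inr i)) = 1) := by
  obtain ⟨h1, h2, h3⟩ := pgInd_ker_coordForm e p ![1, 0, 0]
  refine ⟨fun z => by simp [h1], ?_⟩
  rintro (_ | m)
  · simp [h3]
  · simp [h2]

lemma pgInd_vertical (e : Basis (Fin 3) F (Fin 3 → F)) (p : ℕ) (a : F) :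
    (∀ z, pgInd p F 2 (LinearMap.ker (coordForm e ![-a, 1, 0])) (pgCoordPoint e (.inl z)) =
      if z.1 = a then 1 else 0) ∧
    (∀ m, pgInd p F 2 (LinearMap.ker (coordForm e ![-a, 1, 0]))
      (pgCoordPoint e (.inr (some m))) = 0) ∧
    pgInd p F 2 (LinearMap.ker (coordForm e ![-a, 1, 0])) (pgCoordPoint e (.inr none)) = 1 := by
  obtain ⟨h1, h2, h3⟩ := pgInd_ker_coordForm e p ![-a, 1, 0]
  exact ⟨fun z => by simp [h1, neg_add_eq_zero, eq_comm], fun m => by simp [h2], by simp [h3]⟩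

lemma pgInd_horizontal (e : Basis (Fin 3) F (Fin 3 → F)) (p : ℕ) (b : F) :
    (∀ z, pgInd p F 2 (LinearMap.ker (coordForm e ![-b, 0, 1])) (pgCoordPoint e (.inl z)) =
      if z.2 = b then 1 else 0) ∧
    (∀ m, pgInd p F 2 (LinearMap.ker (coordForm e ![-b, 0, 1]))
      (pgCoordPoint e (.inr (some m))) = if m = 0 then 1 else 0) ∧
    pgInd p F 2 (LinearMap.ker (coordForm e ![-b, 0, 1])) (pgCoordPoint e (.inr none)) = 0 := by
  obtain ⟨h1, h2, h3⟩ := pgInd_ker_coordForm e p ![-b, 0, 1]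
  exact ⟨fun z => by simp [h1, neg_add_eq_zero, eq_comm], fun m => by simp [h2], by simp [h3]⟩

lemma sum_eq_of_const_off_three {F : Type} [Fintype F] {a₁ a₂ a₃ : F} (h12 : a₁ ≠ a₂) (h13 : a₁ ≠ a₃)
    (h23 : a₂ ≠ a₃) (f : F → ℕ) (k : ℕ) (hf : ∀ x, x ≠ a₁ → x ≠ a₂ → x ≠ a₃ → f x = k) :
    ∑ x, f x = f a₁ + f a₂ + f a₃ + (Fintype.card F - 3) * k := by
  have hcompl : ∑ x ∈ {a₁, a₂, a₃}ᶜ, f x = (Fintype.card F - 3) * k := by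
    rw [Finset.sum_congr rfl (g := fun _ => k), Finset.sum_const, Finset.card_compl,
      Finset.card_eq_three.2 ⟨a₁, a₂, a₃, h12, h13, h23, rfl⟩, smul_eq_mul]
    intro x hx
    simp only [Finset.mem_compl, Finset.mem_insert, Finset.mem_singleton, not_or] at hx
    exact hf x hx.1 hx.2.1 hx.2.2
  rw [← Finset.sum_add_sum_compl {a₁, a₂, a₃}, hcompl, Finset.sum_insert (by simp [h12, h13]),
    Finset.sum_pair h23, ← add_assoc (f a₁)]

/-- The function `1, 1, -1` at three elements and `0` elsewhere. -/
def threeValues {F : Type} (p : ℕ) (a₁ a₂ a₃ x : F) : ZMod p :=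
  (if x = a₁ then 1 else 0) + (if x = a₂ then 1 else 0) - (if x = a₃ then 1 else 0)

lemma sum_threeValues_ne_zero {F : Type} [Fintype F] {p : ℕ} {a₁ a₂ a₃ b₁ b₂ b₃ : F}
    (ha12 : a₁ ≠ a₂) (ha13 : a₁ ≠ a₃) (ha23 : a₂ ≠ a₃)
    (hb12 : b₁ ≠ b₂) (hb13 : b₁ ≠ b₃) (hb23 : b₂ ≠ b₃)
    (h1 : (1 : ZMod p) ≠ 0) (h2 : (1 + 1 : ZMod p) ≠ 0) :
    (∑ x : F, ∑ y : F,
      if threeValues p a₁ a₂ a₃ x + threeValues p b₁ b₂ b₃ y ≠ 0 then 1 else 0) =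
    2 * (2 + (Fintype.card F - 3)) + (1 + (Fintype.card F - 3)) + (Fintype.card F - 3) * 3 := by
  have h2' : (-1 + -1 : ZMod p) ≠ 0 := by
    rw [← neg_add]; exact neg_ne_zero.2 h2
  have val : ∀ {a₁ a₂ a₃ : F}, a₁ ≠ a₂ → a₁ ≠ a₃ → a₂ ≠ a₃ →
      threeValues p a₁ a₂ a₃ a₁ = 1 ∧ threeValues p a₁ a₂ a₃ a₂ = 1 ∧
      threeValues p a₁ a₂ a₃ a₃ = -1 ∧
      ∀ x, x ≠ a₁ → x ≠ a₂ → x ≠ a₃ → threeValues p a₁ a₂ a₃ x = 0 := by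
    intro a₁ a₂ a₃ h12 h13 h23
    refine ⟨?_, ?_, ?_, fun x k1 k2 k3 => ?_⟩ <;>
      simp [threeValues, *, h12.symm, h13.symm, h23.symm]
  obtain ⟨vb1, vb2, vb3, vb⟩ := val hb12 hb13 hb23
  obtain ⟨va1, va2, va3, va⟩ := val ha12 ha13 ha23
  have row1 : (∑ y, if 1 + threeValues p b₁ b₂ b₃ y ≠ 0 then 1 else 0) =
      2 + (Fintype.card F - 3) := by
    rw [sum_eq_of_const_off_three hb12 hb13 hb23 _ 1 fun y k1 k2 k3 => by
      simp [vb y k1 k2 k3, h1]]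
    simp [vb1, vb2, vb3, h2]
  have row2 : (∑ y, if -1 + threeValues p b₁ b₂ b₃ y ≠ 0 then 1 else 0) =
      1 + (Fintype.card F - 3) := by
    rw [sum_eq_of_const_off_three hb12 hb13 hb23 _ 1 fun y k1 k2 k3 => by
      simp [vb y k1 k2 k3, h1]]
    simp [vb1, vb2, vb3, h2']
  have row3 : (∑ y, if 0 + threeValues p b₁ b₂ b₃ y ≠ 0 then 1 else 0) = 3 := by
    rw [sum_eq_of_const_off_three hb12 hb13 hb23 _ 0 fun y k1 k2 k3 => by
      simp [vb y k1 k2 k3]]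
    simp [vb1, vb2, vb3, h1]
  rw [sum_eq_of_const_off_three ha12 ha13 ha23 _ 3 fun x k1 k2 k3 => by
    rw [va x k1 k2 k3, row3]]
  rw [va1, va2, va3, row1, row2]
  ring

lemma pgWt_eq_sum [Fintype F] (e : Basis (Fin 3) F (Fin 3 → F)) {p : ℕ}
    (c : PGPoint F 2 → ZMod p) :
    pgWt p F 2 c = (∑ x, ∑ y, if c (pgCoordPoint e (.inl (x, y))) ≠ 0 then 1 else 0) +
      ((if c (pgCoordPoint e (.inr none)) ≠ 0 then 1 else 0) +
        ∑ m, if c (pgCoordPoint e (.inr (some m))) ≠ 0 then 1 else 0) := by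
  rw [← Fintype.sum_prod_type' (fun x y => if c (pgCoordPoint e (.inl (x, y))) ≠ 0 then 1 else 0),
    ← Fintype.sum_option (fun i => if c (pgCoordPoint e (.inr i)) ≠ 0 then 1 else 0),
    ← Fintype.sum_sum_type (fun s => if c (pgCoordPoint e s) ≠ 0 then 1 else 0),
    ← Finset.card_filter, pgWt, ← Set.ncard_coe_finset,
    ← Set.ncard_image_of_injective _ (pgCoordPoint_bijective e).1]
  congr 1
  ext P
  obtain ⟨s, rfl⟩ := (pgCoordPoint_bijective e).2 P
  simp [(pgCoordPoint_bijective e).1.eq_iff]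

end Weight

/-- Theorem: for `p > 3`, the codeword `c = r₁ + r₂ − r' + s₁ + s₂ − s' − t` built from
three lines through each of two distinct points `R, S` of a line `t` has weight
`7q − 14` and is minimal. -/
theorem statement_14 (p h : ℕ) (hp : p.Prime) (hp3 : 3 < p) (hh : 2 ≤ h)
    (hq27 : 27 < p ^ h)
    (F : Type) [Field F] [Fintype F] (hF : Fintype.card F = p ^ h)
    (t r1 r2 r' s1 s2 s' : Submodule F (Fin 3 → F))
    (R S : PGPoint F 2)
    (htl : finrank F t = 2) (hr1l : finrank F r1 = 2) (hr2l : finrank F r2 = 2)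
    (hr'l : finrank F r' = 2) (hs1l : finrank F s1 = 2) (hs2l : finrank F s2 = 2)
    (hs'l : finrank F s' = 2)
    (hRS : R ≠ S) (hRt : R.1 ≤ t) (hSt : S.1 ≤ t)
    (hRr1 : R.1 ≤ r1) (hRr2 : R.1 ≤ r2) (hRr' : R.1 ≤ r')
    (hSs1 : S.1 ≤ s1) (hSs2 : S.1 ≤ s2) (hSs' : S.1 ≤ s')
    (hr1t : r1 ≠ t) (hr2t : r2 ≠ t) (hr't : r' ≠ t)
    (hs1t : s1 ≠ t) (hs2t : s2 ≠ t) (hs't : s' ≠ t)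
    (hr12 : r1 ≠ r2) (hr1' : r1 ≠ r') (hr2' : r2 ≠ r')
    (hs12 : s1 ≠ s2) (hs1' : s1 ≠ s') (hs2' : s2 ≠ s') :
    let c : PGPoint F 2 → ZMod p := fun P =>
      pgInd p F 2 r1 P + pgInd p F 2 r2 P - pgInd p F 2 r' P +
      pgInd p F 2 s1 P + pgInd p F 2 s2 P - pgInd p F 2 s' P - pgInd p F 2 t P
    c ∈ pgCode p F 2 ∧ pgWt p F 2 c = 7 * p ^ h - 14 ∧ pgMinimal p F 2 c := by
  intro c
  have : Fact p.Prime := ⟨hp⟩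
  have : CharP F p := charP_of_card_eq_prime_pow hF
  let : Algebra (ZMod p) F := ZMod.algebra F p
  have hF0 : (Fintype.card F : ZMod p) = 0 := by
    rw [hF, Nat.cast_pow, CharP.cast_eq_zero, zero_pow (by omega)]
  have hq : 2 * p + 3 < Fintype.card F := by
    rw [hF]
    refine lt_of_lt_of_le ?_ (Nat.pow_le_pow_right hp.pos hh)
    nlinarith
  have natCast_ne_zero : ∀ n : ℕ, 0 < n → n < p → (n : ZMod p) ≠ 0 := fun n h0 hn h =>
    Nat.not_le_of_lt hn (Nat.le_of_dvd h0 ((ZMod.natCast_eq_zero_iff n p).1 h))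
  have h2 : (1 + 1 : ZMod p) ≠ 0 := by
    have := natCast_ne_zero 2 (by omega) (by omega)
    norm_num at this ⊢
    exact this
  have h3 : (3 : ZMod p) ≠ 0 := by simpa using natCast_ne_zero 3 (by omega) (by omega)
  obtain ⟨e, heS, heR⟩ := exists_basis_of_points htl hRS hRt hSt
  have ht := eq_ker_of_mem_infinity e htl (hSt heS) (hRt heR)
  obtain ⟨a₁, rfl⟩ := exists_vertical e hr1l ht (hRr1 heR) hr1t
  obtain ⟨a₂, rfl⟩ := exists_vertical e hr2l ht (hRr2 heR) hr2t
  obtain ⟨a₃, rfl⟩ := exists_vertical e hr'l ht (hRr' heR) hr't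
  obtain ⟨b₁, rfl⟩ := exists_horizontal e hs1l ht (hSs1 heS) hs1t
  obtain ⟨b₂, rfl⟩ := exists_horizontal e hs2l ht (hSs2 heS) hs2t
  obtain ⟨b₃, rfl⟩ := exists_horizontal e hs'l ht (hSs' heS) hs't
  subst ht
  have ha12 : a₁ ≠ a₂ := by rintro rfl; exact hr12 rfl
  have ha13 : a₁ ≠ a₃ := by rintro rfl; exact hr1' rfl
  have ha23 : a₂ ≠ a₃ := by rintro rfl; exact hr2' rfl
  have hb12 : b₁ ≠ b₂ := by rintro rfl; exact hs12 rfl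
  have hb13 : b₁ ≠ b₃ := by rintro rfl; exact hs1' rfl
  have hb23 : b₂ ≠ b₃ := by rintro rfl; exact hs2' rfl
  obtain ⟨t1, t2⟩ := pgInd_infinity e p
  have v1 := fun a => (pgInd_vertical e p a).1
  have v2 := fun a => (pgInd_vertical e p a).2.1
  have v3 := fun a => (pgInd_vertical e p a).2.2
  have w1 := fun b => (pgInd_horizontal e p b).1
  have w2 := fun b => (pgInd_horizontal e p b).2.1
  have w3 := fun b => (pgInd_horizontal e p b).2.2
  have hcAff : ∀ x y, c (pgCoordPoint e (.inl (x, y))) =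
      threeValues p a₁ a₂ a₃ x + threeValues p b₁ b₂ b₃ y := fun x y => by
    simp only [c, t1, v1, w1, threeValues]; ring
  have hcInf : ∀ m, c (pgCoordPoint e (.inr (some m))) = (if m = 0 then 1 else 0) - 1 :=
    fun m => by simp only [c, t2, v2, w2]; ring
  have hcNone : c (pgCoordPoint e (.inr none)) = 0 := by simp only [c, t2, v3, w3]; ring
  have line_mem : ∀ {H : Submodule F (Fin 3 → F)}, finrank F H = 2 →
      pgInd p F 2 H ∈ pgCode p F 2 := fun h => Submodule.subset_span ⟨_, h, rfl⟩
  refine ⟨?_, ?_, ?_⟩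
  · exact Submodule.sub_mem _ (Submodule.sub_mem _ (Submodule.add_mem _ (Submodule.add_mem _
      (Submodule.sub_mem _ (Submodule.add_mem _ (line_mem hr1l) (line_mem hr2l)) (line_mem hr'l))
      (line_mem hs1l)) (line_mem hs2l)) (line_mem hs'l)) (line_mem htl)
  · have hsum : (∑ m, if c (pgCoordPoint e (.inr (some m))) ≠ 0 then 1 else 0) =
        Fintype.card F - 1 := by
      have : ∀ m, (c (pgCoordPoint e (.inr (some m))) ≠ 0) ↔ m ≠ 0 := fun m => by
        by_cases hm : m = 0 <;> simp [hcInf, hm]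
      simp only [this]
      rw [← Finset.card_filter, Finset.filter_ne', Finset.card_erase_of_mem (Finset.mem_univ _),
        Finset.card_univ]
    rw [pgWt_eq_sum e, hsum, hcNone]
    simp only [hcAff]
    rw [sum_threeValues_ne_zero ha12 ha13 ha23 hb12 hb13 hb23 one_ne_zero h2, hF]
    simp only [ne_eq, not_true_eq_false, if_false]
    omega
  · intro c' hc' hsub
    have hzero : ∀ P, c P = 0 → c' P = 0 := fun P hP => by
      by_contra h
      exact hsub h hP
    obtain ⟨η₁, η₂, η₃, γ₁, γ₂, γ₃, hg⟩ := affineCode_supported_on_grid hq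
      (affine_part_mem_affineCode e hc') ha12 ha13 ha23 hb12 hb13 hb23
      (fun x y k1 k2 k3 l1 l2 l3 => hzero _ (by simp [threeValues, *]))
    have e1 : η₁ + γ₃ = 0 := by
      simpa [ha12, ha13, hb13.symm, hb23.symm] using (hg a₁ b₃).symm.trans
        (hzero _ (by simp [hcAff, threeValues, ha12, ha13, hb13.symm, hb23.symm]))
    have e2 : η₂ + γ₃ = 0 := by
      simpa [ha12.symm, ha23, hb13.symm, hb23.symm] using (hg a₂ b₃).symm.trans
        (hzero _ (by simp [hcAff, threeValues, ha12.symm, ha23, hb13.symm, hb23.symm]))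
    have e3 : η₃ + γ₁ = 0 := by
      simpa [ha13.symm, ha23.symm, hb12, hb13] using (hg a₃ b₁).symm.trans
        (hzero _ (by simp [hcAff, threeValues, ha13.symm, ha23.symm, hb12, hb13]))
    have e4 : η₃ + γ₂ = 0 := by
      simpa [ha13.symm, ha23.symm, hb12.symm, hb23] using (hg a₃ b₂).symm.trans
        (hzero _ (by simp [hcAff, threeValues, ha13.symm, ha23.symm, hb12.symm, hb23]))
    have hd := fun m => pgCode_eq_of_affine_part_eq_zero e hF0
      (Submodule.sub_mem _ hc' (Submodule.add_mem _ (Submodule.add_mem _ (Submodule.add_mem _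
        (Submodule.add_mem _ (Submodule.add_mem _
        (Submodule.smul_mem _ η₁ (line_mem hr1l)) (Submodule.smul_mem _ η₂ (line_mem hr2l)))
        (Submodule.smul_mem _ η₃ (line_mem hr'l))) (Submodule.smul_mem _ γ₁ (line_mem hs1l)))
        (Submodule.smul_mem _ γ₂ (line_mem hs2l))) (Submodule.smul_mem _ γ₃ (line_mem hs'l))))
      (fun z => by
        simp only [Pi.sub_apply, Pi.add_apply, Pi.smul_apply, smul_eq_mul, v1, w1]
        exact sub_eq_zero.2 (hg z.1 z.2)) m
    simp only [Pi.sub_apply, Pi.add_apply, Pi.smul_apply, smul_eq_mul, v2, v3, w2, w3,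
      hzero _ hcNone] at hd
    have hd0 := hd 0
    rw [hzero _ (by rw [hcInf]; simp)] at hd0
    simp only [if_true] at hd0
    have hηγ : γ₁ = η₁ := mul_left_cancel₀ h3 (by
      linear_combination -hd0 - e4 + 2 * e3 + e2 - 2 * e1)
    refine ⟨η₁, funext fun P => ?_⟩
    obtain ⟨s, rfl⟩ := (pgCoordPoint_bijective e).2 P
    rw [Pi.smul_apply, smul_eq_mul]
    rcases s with ⟨x, y⟩ | _ | m
    · rw [hg, hcAff, threeValues, threeValues]
      subst hηγ
      rw [eq_neg_of_add_eq_zero_left e3, eq_neg_of_add_eq_zero_right e1,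
        show η₂ = γ₁ by linear_combination e2 - e1, show γ₂ = γ₁ by linear_combination e4 - e3]
      ring
    · rw [hcNone, hzero _ hcNone, mul_zero]
    · rw [hcInf]
      by_cases hm : m = 0
      · subst hm
        rw [hzero _ (by rw [hcInf]; simp)]
        simp
      · have := hd m
        simp only [hm, if_false] at this ⊢
        linear_combination this - e2 - e3 + e1 + hηγ
end
end
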